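/- Suppose the grouplikes of H have order p and H₀ ≅ kG(H) ⊕ M*(p,k)^t as coalgebras with t ≥ p−3. Then the dual Hopf algebra H* has no nontrivial skew-primitive elements. -/

import Mathlib

open TensorProduct

namespace HopfClass

variable (k : Type*) [Field k]

section Wrt

variable {M : Type*} [AddCommGroup M] [Module k M]

/-- A subspace `C` is a subcoalgebra with respect to a comultiplication-like map `Δ`
if `Δ` maps `C` into the image of `C ⊗ C` in `M ⊗ M`. -/
def IsSubcoalgWrt (Δ : M →ₗ[k] M ⊗[k] M) (C : Submodule k M) : Prop :=
  ∀ x ∈ C, Δ x ∈ LinearMap.range (TensorProduct.map C.subtype C.subtype)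

/-- A simple subcoalgebra: a nonzero subcoalgebra with no nonzero proper subcoalgebras. -/
def IsSimpleSubcoalgWrt (Δ : M →ₗ[k] M ⊗[k] M) (C : Submodule k M) : Prop :=
  IsSubcoalgWrt k Δ C ∧ C ≠ ⊥ ∧
    ∀ D : Submodule k M, IsSubcoalgWrt k Δ D → D < C → D = ⊥

/-- Pointedness: every simple subcoalgebra is one-dimensional. -/
def IsPointedWrt (Δ : M →ₗ[k] M ⊗[k] M) : Prop :=
  ∀ C : Submodule k M, IsSimpleSubcoalgWrt k Δ C → Module.finrank k C = 1

/-- Grouplike element with respect to `Δ`. -/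
def IsGrouplikeWrt (Δ : M →ₗ[k] M ⊗[k] M) (g : M) : Prop :=
  g ≠ 0 ∧ Δ g = g ⊗ₜ[k] g

/-- `y` is a `(h, g)`-skew-primitive with respect to `Δ`, i.e. `Δ y = g ⊗ y + y ⊗ h`. -/
def IsSkewPrimitiveWrt (Δ : M →ₗ[k] M ⊗[k] M) (g h y : M) : Prop :=
  Δ y = g ⊗ₜ[k] y + y ⊗ₜ[k] h

/-- There are no nontrivial skew-primitive elements: every skew-primitive between grouplikes
is a scalar multiple of the difference of the grouplikes. -/
def HasNoNontrivialSkewPrimitivesWrt (Δ : M →ₗ[k] M ⊗[k] M) : Prop :=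
  ∀ g h y : M, IsGrouplikeWrt k Δ g → IsGrouplikeWrt k Δ h →
    IsSkewPrimitiveWrt k Δ g h y → ∃ c : k, y = c • (g - h)

end Wrt

section Coalg

variable (H : Type*) [AddCommGroup H] [Module k H] [Coalgebra k H]

/-- The comultiplication of a coalgebra, as a linear map. -/
noncomputable abbrev comulL : H →ₗ[k] H ⊗[k] H := CoalgebraStruct.comul

/-- The coradical of a coalgebra: the sum of all its simple subcoalgebras. -/
noncomputable def coradical : Submodule k H :=
  sSup {C : Submodule k H | IsSimpleSubcoalgWrt k (comulL k H) C}

/-- A coalgebra is cosemisimple if it equals its coradical. -/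
def IsCosemisimple : Prop := coradical k H = ⊤

/-- A coalgebra is pointed if all its simple subcoalgebras are one-dimensional. -/
def IsPointed : Prop := IsPointedWrt k (comulL k H)

/-- The set of grouplike elements. -/
def grouplikes : Set H := {g : H | IsGrouplikeWrt k (comulL k H) g}

/-- `e` is a multiplicative matrix of size `n` spanning the subspace `C`, i.e. a
linearly independent family with `Δ(e i j) = ∑ l, e i l ⊗ e l j` and `ε(e i j) = δ_ij`
whose span is `C`; this says precisely that `C` is a simple matrix subcoalgebra
isomorphic to `M*(n,k)`, the dual of the `n × n` matrix algebra. -/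
def IsMultMatrix (n : ℕ) (C : Submodule k H) (e : Fin n → Fin n → H) : Prop :=
  LinearIndependent k (fun p : Fin n × Fin n => e p.1 p.2) ∧
  C = Submodule.span k (Set.range fun p : Fin n × Fin n => e p.1 p.2) ∧
  (∀ i j, CoalgebraStruct.comul (R := k) (e i j) = ∑ l : Fin n, e i l ⊗ₜ[k] e l j) ∧
  (∀ i j, Coalgebra.counit (R := k) (e i j) = if i = j then (1 : k) else 0)

/-- `C` is a (simple matrix) subcoalgebra isomorphic to the matrix coalgebra `M*(n,k)`. -/
def IsMatrixSubcoalg (n : ℕ) (C : Submodule k H) : Prop :=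
  ∃ e : Fin n → Fin n → H, IsMultMatrix k H n C e

end Coalg

section Dual

variable (H : Type*) [Ring H] [Algebra k H] [FiniteDimensional k H]

/-- The comultiplication on the dual of a finite-dimensional algebra:
the dual map of the multiplication, composed with the canonical identification
`(H ⊗ H)* ≃ H* ⊗ H*`. -/
noncomputable def dualComul :
    Module.Dual k H →ₗ[k] Module.Dual k H ⊗[k] Module.Dual k H :=
  (TensorProduct.dualDistribEquiv k H H).symm.toLinearMap ∘ₗ
    (LinearMap.mul' k H).dualMap

/-- A finite-dimensional Hopf algebra is copointed if its dual is pointed. -/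
def IsCopointed : Prop := IsPointedWrt k (dualComul k H)

/-- The grouplike elements of the dual Hopf algebra. -/
def dualGrouplikes : Set (Module.Dual k H) :=
  {f : Module.Dual k H | IsGrouplikeWrt k (dualComul k H) f}

end Dual

section Taft

variable (p : ℕ) (q : k)

/-- `B` is (isomorphic to) the Taft Hopf algebra `T_q` of dimension `p²`: `q` is a primitive
`p`-th root of unity, `B` has dimension `p²` and is generated as an algebra by a grouplike `g`
and a `(1,g)`-skew-primitive `x` with `g^p = 1`, `x^p = 0` and `g x = q x g`. -/
def IsTaftAlgebra (B : Type*) [Ring B] [Bialgebra k B] : Prop :=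
  IsPrimitiveRoot q p ∧ Module.finrank k B = p ^ 2 ∧
  ∃ g x : B,
    IsGrouplikeWrt k (comulL k B) g ∧
    CoalgebraStruct.comul (R := k) x = x ⊗ₜ[k] (1 : B) + g ⊗ₜ[k] x ∧
    g ^ p = 1 ∧ x ^ p = 0 ∧ g * x = q • (x * g) ∧
    Algebra.adjoin k {g, x} = (⊤ : Subalgebra k B)

variable {H : Type*} [Ring H] [Bialgebra k H]

/-- The subalgebra `T` of `H` is a sub-Hopf algebra isomorphic to the Taft algebra `T_q` of
dimension `p²`, generated by a grouplike `g` and a `(1,g)`-skew-primitive `x` satisfying the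
Taft relations. -/
def IsTaftSubalgebra (T : Subalgebra k H) : Prop :=
  IsPrimitiveRoot q p ∧ Module.finrank k T = p ^ 2 ∧
  ∃ g x : H,
    IsGrouplikeWrt k (comulL k H) g ∧
    CoalgebraStruct.comul (R := k) x = x ⊗ₜ[k] (1 : H) + g ⊗ₜ[k] x ∧
    g ^ p = 1 ∧ x ^ p = 0 ∧ g * x = q • (x * g) ∧
    Algebra.adjoin k {g, x} = T

/-- The right coinvariants `H^{co π}` of a linear map `π : H → B` on a bialgebra `H`:
elements `h` with `(id ⊗ π)(Δ h) = h ⊗ 1`. -/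
def rightCoinvariants {B : Type*} [Ring B] [Bialgebra k B] (π : H →ₗ[k] B) : Set H :=
  {h : H | (TensorProduct.map LinearMap.id π) (CoalgebraStruct.comul (R := k) h)
      = h ⊗ₜ[k] (1 : B)}

end Taft

end HopfClass

namespace HopfDual

open HopfClass Module

lemma eq_of_dual {k H : Type*} [Field k] [AddCommGroup H] [Module k H] {x y : H}
    (h : ∀ f : Dual k H, f x = f y) : x = y := by
  rw [← sub_eq_zero, ← Module.forall_dual_apply_eq_zero_iff k]
  intro f; rw [map_sub, h f, sub_self]

section Actions

variable {k H : Type*} [Field k] [AddCommGroup H] [Module k H] [Coalgebra k H]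

/-- The left action of a functional on a coalgebra, `h ↦ h₁ f(h₂)`. -/
noncomputable def act (f : Dual k H) : H →ₗ[k] H :=
  (TensorProduct.rid k H).toLinearMap ∘ₗ f.lTensor H ∘ₗ comulL k H

/-- The right action of a functional on a coalgebra, `h ↦ f(h₁) h₂`. -/
noncomputable def coact (f : Dual k H) : H →ₗ[k] H :=
  (TensorProduct.lid k H).toLinearMap ∘ₗ f.rTensor H ∘ₗ comulL k H

lemma act_eq_sum {ι : Type*} {s : Finset ι} {a b : ι → H} {h : H}
    (r : comulL k H h = ∑ i ∈ s, a i ⊗ₜ[k] b i) (f : Dual k H) :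
    act f h = ∑ i ∈ s, f (b i) • a i := by
  simp [act, r, map_sum]

lemma coact_eq_sum {ι : Type*} {s : Finset ι} {a b : ι → H} {h : H}
    (r : comulL k H h = ∑ i ∈ s, a i ⊗ₜ[k] b i) (f : Dual k H) :
    coact f h = ∑ i ∈ s, f (a i) • b i := by
  simp [coact, r, map_sum]

lemma act_repr {ι : Type*} {h : H} (r : Coalgebra.Repr k h ι) (f : Dual k H) :
    act f h = ∑ i ∈ r.index, f (r.right i) • r.left i :=
  act_eq_sum r.eq.symm f

lemma coact_repr {ι : Type*} {h : H} (r : Coalgebra.Repr k h ι) (f : Dual k H) :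
    coact f h = ∑ i ∈ r.index, f (r.left i) • r.right i :=
  coact_eq_sum r.eq.symm f

lemma counit_act (f : Dual k H) (h : H) : Coalgebra.counit (R := k) (act f h) = f h := by
  have r := Coalgebra.Repr.arbitrary k h
  rw [act_repr r, map_sum]
  conv_rhs => rw [← Coalgebra.sum_counit_smul r, map_sum]
  simp [mul_comm]

lemma apply_act (f g : Dual k H) (h : H) : f (act g h) = g (coact f h) := by
  have r := Coalgebra.Repr.arbitrary k h
  rw [act_repr r, coact_repr r, map_sum, map_sum]
  simp [mul_comm]

lemma comul_act (f : Dual k H) (h : H) :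
    comulL k H (act f h) = (act f).lTensor H (comulL k H h) := by
  have key : comulL k H ∘ₗ (TensorProduct.rid k H).toLinearMap ∘ₗ f.lTensor H =
      ((TensorProduct.rid k H).toLinearMap ∘ₗ f.lTensor H).lTensor H ∘ₗ
        (TensorProduct.assoc k H H H).toLinearMap ∘ₗ (comulL k H).rTensor H := by
    ext a b
    simp only [TensorProduct.AlgebraTensorModule.curry_apply, LinearMap.coe_comp,
      LinearMap.restrictScalars_self, TensorProduct.curry_apply, Function.comp_apply,
      LinearMap.lTensor_tmul, LinearEquiv.coe_coe, TensorProduct.rid_tmul, map_smul,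
      LinearMap.rTensor_tmul]
    induction comulL k H a using TensorProduct.induction_on with
    | zero => simp
    | tmul x y => simp
    | add x y hx hy => simp [hx, hy, TensorProduct.add_tmul]
  have h1 := LinearMap.congr_fun key (comulL k H h)
  have h2 := Coalgebra.coassoc_apply (R := k) h
  simp only [LinearMap.comp_apply, LinearEquiv.coe_coe] at h1 h2
  rw [act, LinearMap.comp_apply, LinearMap.comp_apply, LinearEquiv.coe_coe, h1, h2]
  rw [← LinearMap.comp_apply (LinearMap.lTensor H _), ← LinearMap.lTensor_comp]
  rfl

lemma act_coact (f g : Dual k H) (h : H) : act f (coact g h) = coact g (act f h) := by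
  have key : (TensorProduct.lid k H).toLinearMap ∘ₗ g.rTensor H ∘ₗ (act f).lTensor H =
      act f ∘ₗ (TensorProduct.lid k H).toLinearMap ∘ₗ g.rTensor H := by
    ext a b; simp
  have h1 := LinearMap.congr_fun key (comulL k H h)
  simp only [LinearMap.comp_apply] at h1
  rw [coact, LinearMap.comp_apply, LinearMap.comp_apply, ← h1, LinearMap.comp_apply,
    LinearMap.comp_apply, comul_act]

lemma coact_counit (h : H) : coact (Coalgebra.counit (R := k)) h = h := by
  simp [coact, Coalgebra.rTensor_counit_comul]

lemma act_counit (h : H) : act (Coalgebra.counit (R := k)) h = h := by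
  simp [act, Coalgebra.lTensor_counit_comul]

lemma counit_coact (f : Dual k H) (h : H) :
    Coalgebra.counit (R := k) (coact f h) = f h := by
  rw [← apply_act, act_counit]

/-- An operator commuting with all `act f` is a `coact`. -/
lemma eq_coact {T : H →ₗ[k] H} (hT : ∀ (f : Dual k H) h, T (act f h) = act f (T h)) :
    T = coact (Coalgebra.counit (R := k) ∘ₗ T) := by
  ext h
  refine eq_of_dual (k := k) fun f => ?_
  rw [← apply_act, LinearMap.comp_apply, hT, counit_act]

lemma eq_act {T : H →ₗ[k] H} (hT : ∀ (f : Dual k H) h, T (coact f h) = coact f (T h)) :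
    T = act (Coalgebra.counit (R := k) ∘ₗ T) := by
  ext h
  refine eq_of_dual (k := k) fun f => ?_
  rw [apply_act, LinearMap.comp_apply, hT, counit_coact]

variable (k H) in
/-- The algebra of operators `act f`, as the commutant of the operators `coact f`. -/
noncomputable def actAlgebra : Subalgebra k (Module.End k H) :=
  Subalgebra.centralizer k (Set.range (coact (k := k) (H := H)))

lemma mem_actAlgebra {T : Module.End k H} :
    T ∈ actAlgebra k H ↔ ∀ (f : Dual k H) h, T (coact f h) = coact f (T h) := by
  simp only [actAlgebra, Subalgebra.mem_centralizer_iff, Set.forall_mem_range]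
  exact forall_congr' fun f => ⟨fun h x => (LinearMap.congr_fun h x).symm,
    fun h => LinearMap.ext fun x => (h x).symm⟩

lemma act_mem (f : Dual k H) : act f ∈ actAlgebra k H :=
  mem_actAlgebra.2 fun _ _ => act_coact _ _ _

/-- Right coideals. -/
def IsRC (X : Submodule k H) : Prop := ∀ f : Dual k H, ∀ x ∈ X, act f x ∈ X

lemma IsRC.apply_mem {X : Submodule k H} (hX : IsRC X) {T : Module.End k H}
    (hT : T ∈ actAlgebra k H) {x : H} (hx : x ∈ X) : T x ∈ X := by
  rw [eq_act (mem_actAlgebra.1 hT)]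
  exact hX _ _ hx

lemma IsRC.map_coact {X : Submodule k H} (hX : IsRC X) (f : Dual k H) :
    IsRC (X.map (coact f)) := by
  rintro g _ ⟨x, hx, rfl⟩
  exact ⟨act g x, hX g x hx, (act_coact g f x).symm⟩

lemma IsRC.inf {X Y : Submodule k H} (hX : IsRC X) (hY : IsRC Y) : IsRC (X ⊓ Y) :=
  fun f x hx => ⟨hX f x hx.1, hY f x hx.2⟩

lemma IsRC.sup {X Y : Submodule k H} (hX : IsRC X) (hY : IsRC Y) : IsRC (X ⊔ Y) := by
  intro f x hx
  obtain ⟨y, hy, z, hz, rfl⟩ := Submodule.mem_sup.1 hx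
  rw [map_add]
  exact Submodule.add_mem_sup (hX f y hy) (hY f z hz)

lemma IsRC.comap_coact {X : Submodule k H} (hX : IsRC X) (f : Dual k H) :
    IsRC (X.comap (coact f)) := by
  intro g x hx
  rw [Submodule.mem_comap, ← act_coact]
  exact hX g _ hx

lemma isRC_ker_coact (f : Dual k H) : IsRC (LinearMap.ker (coact f)) := by
  intro g x hx
  rw [LinearMap.mem_ker] at hx ⊢
  rw [← act_coact, hx, map_zero]

/-- Simple right coideals. -/
def IsSimpleRC (S : Submodule k H) : Prop :=
  IsRC S ∧ S ≠ ⊥ ∧ ∀ Y ≤ S, IsRC Y → Y ≠ ⊥ → Y = S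

/-- A right coideal as a module over the algebra of operators `act f`. -/
def IsRC.toSubmodule {X : Submodule k H} (hX : IsRC X) : Submodule (actAlgebra k H) H where
  carrier := X
  add_mem' := X.add_mem
  zero_mem' := X.zero_mem
  smul_mem' T _ hx := hX.apply_mem T.2 hx

lemma isRC_restrictScalars (Y : Submodule (actAlgebra k H) H) : IsRC (Y.restrictScalars k) :=
  fun f _ hx => Y.smul_mem ⟨act f, act_mem f⟩ hx

lemma IsSimpleRC.isSimpleModule {S : Submodule k H} (hS : IsSimpleRC S) :
    IsSimpleModule (actAlgebra k H) hS.1.toSubmodule := by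
  rw [isSimpleModule_iff_isAtom]
  refine ⟨fun h => hS.2.1 ?_, fun Y hY => ?_⟩
  · rw [Submodule.eq_bot_iff] at h ⊢
    exact h
  · by_contra hne
    have h1 : Y.restrictScalars k ≤ S := fun x hx => hY.le hx
    have h2 := hS.2.2 _ h1 (isRC_restrictScalars Y) (by simpa using hne)
    exact hY.not_ge fun x hx => by
      have : x ∈ Y.restrictScalars k := h2 ▸ hx
      exact this

/-- `coact f` as a linear map over the algebra of operators `act f`. -/
noncomputable def coactLinear (f : Dual k H) : H →ₗ[actAlgebra k H] H where
  toFun := coact f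
  map_add' := map_add _
  map_smul' T x := (mem_actAlgebra.1 T.2 f x).symm

lemma exists_coact_eq {S : Submodule k H} (hS : IsRC S)
    (θ : hS.toSubmodule →ₗ[actAlgebra k H] H) :
    ∃ φ : Dual k H, ∀ s : hS.toSubmodule, θ s = coact φ s := by
  let θk : S →ₗ[k] H :=
    { toFun := fun s => θ ⟨s.1, s.2⟩
      map_add' := fun a b => θ.map_add ⟨a.1, a.2⟩ ⟨b.1, b.2⟩
      map_smul' := fun c a => θ.map_smul (algebraMap k (actAlgebra k H) c) ⟨a.1, a.2⟩ }
  obtain ⟨φ, hφ⟩ := LinearMap.exists_extend (Coalgebra.counit (R := k) ∘ₗ θk)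
  refine ⟨φ, fun s => eq_of_dual (k := k) fun f => ?_⟩
  have h1 : θ (⟨act f s, hS f s s.2⟩ : hS.toSubmodule) = act f (θ s) :=
    θ.map_smul ⟨act f, act_mem f⟩ s
  have h2 := LinearMap.congr_fun hφ ⟨act f s, hS f s s.2⟩
  rw [← apply_act, ← counit_act, ← h1]
  exact h2.symm

end Actions

lemma nonempty_linearEquiv_of_le_isotypicComponent {R M : Type*} [Ring R] [AddCommGroup M]
    [Module R M] {N S : Submodule R M} [IsSimpleModule R N] [IsSimpleModule R S]
    (h : N ≤ isotypicComponent R M S) : Nonempty (N ≃ₗ[R] S) := by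
  have inst : ∀ m : {m : Submodule R M | Nonempty (m ≃ₗ[R] S)}, IsSimpleModule R m :=
    fun m => .congr m.2.some
  obtain ⟨T, ⟨e'⟩, ⟨e⟩⟩ := Submodule.linearEquiv_of_le_sSup _ _ h
  exact ⟨e.trans e'⟩

section Subcoalgebras

variable {k H : Type*} [Field k] [AddCommGroup H] [Module k H] [Coalgebra k H]

lemma act_mem_of_isSubcoalg {D : Submodule k H} (hD : IsSubcoalgWrt k (comulL k H) D) :
    IsRC D := by
  intro f x hx
  obtain ⟨z, hz⟩ := hD x hx
  rw [act, LinearMap.comp_apply, LinearMap.comp_apply, ← hz]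
  clear hz
  induction z using TensorProduct.induction_on with
  | zero => simp
  | tmul a b => simpa using D.smul_mem _ a.2
  | add a b ha hb => simp only [map_add]; exact D.add_mem ha hb

lemma coact_mem_of_isSubcoalg {D : Submodule k H} (hD : IsSubcoalgWrt k (comulL k H) D)
    (f : Dual k H) {x : H} (hx : x ∈ D) : coact f x ∈ D := by
  obtain ⟨z, hz⟩ := hD x hx
  rw [coact, LinearMap.comp_apply, LinearMap.comp_apply, ← hz]
  clear hz
  induction z using TensorProduct.induction_on with
  | zero => simp
  | tmul a b => simpa using D.smul_mem _ b.2
  | add a b ha hb => simp only [map_add]; exact D.add_mem ha hb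

lemma comul_eq_sum_act {ι : Type*} [Fintype ι] (b : Basis ι k H) (x : H) :
    comulL k H x = ∑ i, act (b.coord i) x ⊗ₜ[k] b i := by
  have key : ∀ z : H ⊗[k] H,
      z = ∑ i, (TensorProduct.rid k H) ((b.coord i).lTensor H z) ⊗ₜ[k] b i := by
    intro z
    induction z using TensorProduct.induction_on with
    | zero => simp
    | tmul u v =>
      conv_lhs => rw [← b.sum_repr v, TensorProduct.tmul_sum]
      simp [TensorProduct.smul_tmul]
    | add u v hu hv =>
      conv_lhs => rw [hu, hv]
      simp [TensorProduct.add_tmul, Finset.sum_add_distrib]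
  exact key _

lemma comul_eq_sum_coact {ι : Type*} [Fintype ι] (b : Basis ι k H) (x : H) :
    comulL k H x = ∑ i, b i ⊗ₜ[k] coact (b.coord i) x := by
  have key : ∀ z : H ⊗[k] H,
      z = ∑ i, b i ⊗ₜ[k] (TensorProduct.lid k H) ((b.coord i).rTensor H z) := by
    intro z
    induction z using TensorProduct.induction_on with
    | zero => simp
    | tmul u v =>
      conv_lhs => rw [← b.sum_repr u, TensorProduct.sum_tmul]
      simp [TensorProduct.smul_tmul]
    | add u v hu hv =>
      conv_lhs => rw [hu, hv]
      simp [TensorProduct.tmul_add, Finset.sum_add_distrib]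
  exact key _

variable [FiniteDimensional k H]

lemma isSubcoalg_of_stable {D : Submodule k H} (h1 : IsRC D)
    (h2 : ∀ (f : Dual k H), ∀ x ∈ D, coact f x ∈ D) : IsSubcoalgWrt k (comulL k H) D := by
  intro x hx
  obtain ⟨P, hP⟩ := D.subtype.exists_leftInverse_of_injective (by simp)
  have hP' : ∀ y ∈ D, ((P y : D) : H) = y := fun y hy =>
    congrArg Subtype.val (LinearMap.congr_fun hP ⟨y, hy⟩)
  have e1 : (D.subtype ∘ₗ P).rTensor H (comulL k H x) = comulL k H x := by
    rw [comul_eq_sum_act (finBasis k H), map_sum]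
    refine Finset.sum_congr rfl fun i _ => ?_
    simp [hP' _ (h1 _ x hx)]
  have e2 : (D.subtype ∘ₗ P).lTensor H (comulL k H x) = comulL k H x := by
    rw [comul_eq_sum_coact (finBasis k H), map_sum]
    refine Finset.sum_congr rfl fun i _ => ?_
    simp [hP' _ (h2 _ x hx)]
  refine ⟨TensorProduct.map P P (comulL k H x), ?_⟩
  rw [TensorProduct.map_map]
  conv_rhs => rw [← e2, ← e1]
  rw [LinearMap.lTensor, LinearMap.rTensor, TensorProduct.map_map, LinearMap.id_comp,
    LinearMap.comp_id]

lemma exists_simple_subcoalg {D : Submodule k H} (hD : IsSubcoalgWrt k (comulL k H) D)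
    (h0 : D ≠ ⊥) : ∃ D' ≤ D, IsSimpleSubcoalgWrt k (comulL k H) D' := by
  obtain ⟨D', ⟨h1, h2, h3⟩, hmin⟩ := WellFounded.has_min (wellFounded_lt (α := Submodule k H))
    {X | IsSubcoalgWrt k (comulL k H) X ∧ X ≠ ⊥ ∧ X ≤ D} ⟨D, hD, h0, le_rfl⟩
  refine ⟨D', h3, h1, h2, fun X hX hlt => ?_⟩
  by_contra hne
  exact hmin X ⟨hX, hne, hlt.le.trans h3⟩ hlt

lemma exists_simpleRC {X : Submodule k H} (hX : IsRC X) (h0 : X ≠ ⊥) :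
    ∃ S ≤ X, IsSimpleRC S := by
  obtain ⟨D', ⟨h1, h2, h3⟩, hmin⟩ := WellFounded.has_min (wellFounded_lt (α := Submodule k H))
    {Y | IsRC Y ∧ Y ≠ ⊥ ∧ Y ≤ X} ⟨X, hX, h0, le_rfl⟩
  refine ⟨D', h3, h1, h2, fun Y hle hY hne => ?_⟩
  by_contra hlt
  exact hmin Y ⟨hY, hne, hle.trans h3⟩ (lt_of_le_of_ne hle hlt)

/-- A simple right coideal is contained in any nonzero subcoalgebra of its coefficient space. -/
lemma IsSimpleRC.le_coradical {S : Submodule k H} (hS : IsSimpleRC S) : S ≤ coradical k H := by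
  have : IsSimpleModule (actAlgebra k H) hS.1.toSubmodule := hS.isSimpleModule
  set E : Submodule k H := ⨆ f : Dual k H, S.map (coact f) with hE
  have hSE : S ≤ E := fun s hs =>
    le_iSup (fun f : Dual k H => S.map (coact f)) (Coalgebra.counit (R := k))
      ⟨s, hs, coact_counit s⟩
  have hE1 : IsRC E := by
    intro f x hx
    have : E ≤ E.comap (act f) := by
      refine iSup_le fun g => ?_
      rintro _ ⟨s, hs, rfl⟩
      exact le_iSup (fun f : Dual k H => S.map (coact f)) g ⟨act f s, hS.1 f s hs,
        (act_coact f g s).symm⟩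
    exact this hx
  have hE2 : ∀ (f : Dual k H), ∀ x ∈ E, coact f x ∈ E := by
    intro f x hx
    have : E ≤ E.comap (coact f) := by
      refine iSup_le fun g => ?_
      rintro _ ⟨s, hs, rfl⟩
      have h1 : (coact f ∘ₗ coact g : H →ₗ[k] H) =
          coact (Coalgebra.counit (R := k) ∘ₗ (coact f ∘ₗ coact g)) :=
        eq_coact fun φ h => by simp [act_coact]
      rw [Submodule.mem_comap, ← LinearMap.comp_apply, h1]
      exact le_iSup (fun f : Dual k H => S.map (coact f)) _ ⟨s, hs, rfl⟩
    exact this hx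
  have hE0 : E ≠ ⊥ := fun h => hS.2.1 (le_bot_iff.1 (h ▸ hSE))
  obtain ⟨D, hDE, hD⟩ := exists_simple_subcoalg (isSubcoalg_of_stable hE1 hE2) hE0
  obtain ⟨S', hS'D, hS'⟩ := exists_simpleRC (act_mem_of_isSubcoalg hD.1) hD.2.1
  have : IsSimpleModule (actAlgebra k H) hS'.1.toSubmodule := hS'.isSimpleModule
  have hle : hS'.1.toSubmodule ≤ isotypicComponent (actAlgebra k H) H hS.1.toSubmodule := by
    have : E ≤ (isotypicComponent (actAlgebra k H) H hS.1.toSubmodule).restrictScalars k := by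
      refine iSup_le fun f => ?_
      rintro _ ⟨s, hs, rfl⟩
      exact Submodule.map_le_isotypicComponent hS.1.toSubmodule (coactLinear f) ⟨s, hs, rfl⟩
    exact fun x hx => this (hDE (hS'D hx))
  obtain ⟨e⟩ := nonempty_linearEquiv_of_le_isotypicComponent hle
  obtain ⟨φ, hφ⟩ := exists_coact_eq hS'.1 (hS.1.toSubmodule.subtype ∘ₗ e.toLinearMap)
  refine le_trans (fun s hs => ?_) (le_sSup hD)
  have := hφ (e.symm ⟨s, hs⟩)
  simp only [LinearMap.comp_apply, LinearEquiv.coe_coe, LinearEquiv.apply_symm_apply] at this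
  change s = _ at this
  rw [this]
  exact coact_mem_of_isSubcoalg hD.1 _ (hS'D (e.symm ⟨s, hs⟩).2)

end Subcoalgebras

section Matrices

variable {k H : Type*} [Field k] [AddCommGroup H] [Module k H] [Coalgebra k H]

/-- The span of a row of a family. -/
def row {n : ℕ} (e : Fin n → Fin n → H) (i : Fin n) : Submodule k H :=
  Submodule.span k (Set.range (e i))

lemma act_grouplike {g : H} (hg : g ∈ grouplikes k H) (f : Dual k H) : act f g = f g • g := by
  have : comulL k H g = g ⊗ₜ[k] g := hg.2
  simp [act, this]

lemma coact_grouplike {g : H} (hg : g ∈ grouplikes k H) (f : Dual k H) :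
    coact f g = f g • g := by
  have : comulL k H g = g ⊗ₜ[k] g := hg.2
  simp [coact, this]

lemma counit_grouplike {g : H} (hg : g ∈ grouplikes k H) : Coalgebra.counit (R := k) g = 1 := by
  have := act_grouplike hg (Coalgebra.counit (R := k))
  rw [act_counit] at this
  exact smul_left_injective k hg.1 (by simpa using this.symm)

lemma isSimpleRC_line {g : H} (hg : g ∈ grouplikes k H) :
    IsSimpleRC (Submodule.span k {g} : Submodule k H) := by
  refine ⟨?_, by simpa using hg.1, ?_⟩
  · intro f x hx
    obtain ⟨c, rfl⟩ := Submodule.mem_span_singleton.1 hx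
    rw [map_smul, act_grouplike hg]
    exact Submodule.smul_mem _ _ (Submodule.smul_mem _ _ (Submodule.mem_span_singleton_self g))
  · intro Y hle _ hne
    refine le_antisymm hle ?_
    obtain ⟨y, hy, hy0⟩ := Submodule.exists_mem_ne_zero_of_ne_bot hne
    obtain ⟨c, rfl⟩ := Submodule.mem_span_singleton.1 (hle hy)
    have hc : c ≠ 0 := by rintro rfl; simp at hy0
    rw [Submodule.span_singleton_le_iff_mem]
    simpa [smul_smul, hc] using Y.smul_mem c⁻¹ hy

variable {n : ℕ} {C : Submodule k H} {e : Fin n → Fin n → H}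

lemma act_multMatrix (he : IsMultMatrix k H n C e) (f : Dual k H) (i j : Fin n) :
    act f (e i j) = ∑ l, f (e l j) • e i l :=
  act_eq_sum (he.2.2.1 i j) f

lemma coact_multMatrix (he : IsMultMatrix k H n C e) (f : Dual k H) (i j : Fin n) :
    coact f (e i j) = ∑ l, f (e i l) • e l j :=
  coact_eq_sum (he.2.2.1 i j) f

lemma exists_dual_multMatrix (he : IsMultMatrix k H n C e) (a b : Fin n) :
    ∃ f : Dual k H, ∀ i j, f (e i j) = if i = a ∧ j = b then 1 else 0 := by
  obtain ⟨f, hf⟩ := LinearMap.exists_extend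
    ((Basis.span he.1).constr k (fun p => if p = (a, b) then (1 : k) else 0))
  refine ⟨f, fun i j => ?_⟩
  have h1 := LinearMap.congr_fun hf (Basis.span he.1 (i, j))
  simp only [LinearMap.comp_apply, Basis.constr_basis, Prod.mk.injEq] at h1
  rw [← h1, Submodule.subtype_apply, Basis.span_apply]

lemma linearIndependent_row (he : IsMultMatrix k H n C e) (i : Fin n) :
    LinearIndependent k (e i) :=
  he.1.comp (fun j => (i, j)) fun _ _ h => (Prod.mk.inj h).2

lemma finrank_row (he : IsMultMatrix k H n C e) (i : Fin n) :
    finrank k (row (k := k) e i) = n := by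
  rw [row, finrank_span_eq_card (linearIndependent_row he i), Fintype.card_fin]

lemma isSimpleRC_row (he : IsMultMatrix k H n C e) (i : Fin n) :
    IsSimpleRC (row (k := k) e i) := by
  refine ⟨?_, ?_, ?_⟩
  · intro f x hx
    have : row (k := k) e i ≤ (row (k := k) e i).comap (act f) := by
      rw [row, Submodule.span_le]
      rintro _ ⟨j, rfl⟩
      rw [SetLike.mem_coe, Submodule.mem_comap, act_multMatrix he]
      exact Submodule.sum_mem _ fun l _ => Submodule.smul_mem _ _
        (Submodule.subset_span ⟨l, rfl⟩)
    exact this hx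
  · intro h
    have : e i i ∈ row (k := k) e i := Submodule.subset_span ⟨i, rfl⟩
    rw [h, Submodule.mem_bot] at this
    exact he.1.ne_zero (i, i) this
  · intro Y hle hY hne
    refine le_antisymm hle ?_
    obtain ⟨y, hy, hy0⟩ := Submodule.exists_mem_ne_zero_of_ne_bot hne
    obtain ⟨c, rfl⟩ := (Submodule.mem_span_range_iff_exists_fun k).1 (hle hy)
    obtain ⟨j, hj⟩ : ∃ j, c j ≠ 0 := by
      by_contra! h
      simp [h] at hy0
    rw [row, Submodule.span_le]
    rintro _ ⟨m, rfl⟩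
    obtain ⟨f, hf⟩ := exists_dual_multMatrix he m j
    have h1 := hY f _ hy
    have h2 : act f (∑ j, c j • e i j) = c j • e i m := by
      simp only [map_sum, map_smul, act_multMatrix he, hf]
      simp [ite_and]
    rw [h2] at h1
    simpa [smul_smul, hj] using Y.smul_mem (c j)⁻¹ h1

lemma le_iSup_row (he : IsMultMatrix k H n C e) : C ≤ ⨆ i, row (k := k) e i := by
  rw [he.2.1, Submodule.span_le]
  rintro _ ⟨⟨i, j⟩, rfl⟩
  exact le_iSup (fun i => row (k := k) e i) i (Submodule.subset_span ⟨j, rfl⟩)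

end Matrices

section Classification

variable {k H : Type*} [Field k] [AddCommGroup H] [Module k H] [Coalgebra k H]
  [FiniteDimensional k H] {p t : ℕ} {C : Fin t → Submodule k H}

/-- The simple right coideals of a coalgebra with coradical `kG ⊕ ⨁ C i`. -/
lemma IsSimpleRC.eq_line_or (hC : ∀ i, IsMatrixSubcoalg k H p (C i))
    (hsup : coradical k H = Submodule.span k (grouplikes k H) ⊔ ⨆ i, C i)
    {S : Submodule k H} (hS : IsSimpleRC S) :
    (∃ g ∈ grouplikes k H, S = Submodule.span k {g}) ∨ (0 < t ∧ finrank k S = p) := by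
  choose e he using hC
  set s : Set (Submodule (actAlgebra k H) H) :=
    {X | ∃ (Y : Submodule k H) (hY : IsSimpleRC Y), X = hY.1.toSubmodule ∧
      ((∃ g ∈ grouplikes k H, Y = Submodule.span k {g}) ∨ ∃ i j, Y = row (e i) j)} with hs
  have : IsSimpleModule (actAlgebra k H) hS.1.toSubmodule := hS.isSimpleModule
  have inst : ∀ m : s, IsSimpleModule (actAlgebra k H) m := by
    rintro ⟨_, Y, hY, rfl, _⟩
    exact hY.isSimpleModule
  have hle : hS.1.toSubmodule ≤ sSup s := by
    have key : coradical k H ≤ (sSup s).restrictScalars k := by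
      rw [hsup]
      refine sup_le ?_ (iSup_le fun i => (le_iSup_row (he i)).trans (iSup_le fun j => ?_))
      · rw [Submodule.span_le]
        intro g hg
        have : (isSimpleRC_line hg).1.toSubmodule ≤ sSup s :=
          le_sSup ⟨_, isSimpleRC_line hg, rfl, Or.inl ⟨g, hg, rfl⟩⟩
        exact this (Submodule.mem_span_singleton_self g)
      · have : (isSimpleRC_row (he i) j).1.toSubmodule ≤ sSup s :=
          le_sSup ⟨_, isSimpleRC_row (he i) j, rfl, Or.inr ⟨i, j, rfl⟩⟩
        exact fun x hx => this hx
    exact fun x hx => key (hS.le_coradical hx)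
  obtain ⟨_, ⟨Y, hY, rfl, h⟩, ⟨θ⟩⟩ := Submodule.linearEquiv_of_le_sSup _ _ hle
  have θk : S ≃ₗ[k] Y :=
    { toFun := fun s => θ ⟨s.1, s.2⟩
      map_add' := fun a b => θ.map_add ⟨a.1, a.2⟩ ⟨b.1, b.2⟩
      map_smul' := fun c a => θ.map_smul (algebraMap k (actAlgebra k H) c) ⟨a.1, a.2⟩
      invFun := fun s => θ.symm ⟨s.1, s.2⟩
      left_inv := fun s => θ.symm_apply_apply ⟨s.1, s.2⟩
      right_inv := fun s => θ.apply_symm_apply ⟨s.1, s.2⟩ }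
  rcases h with ⟨g, hg, rfl⟩ | ⟨i, j, rfl⟩
  · left
    refine ⟨g, hg, ?_⟩
    have key : S ≤ Submodule.span k {g} := by
      intro x hx
      have hx1 : ∀ f : Dual k H, act f x = f g • x := by
        intro f
        have h1 : (θ ⟨act f x, hS.1 f x hx⟩ : H) = act f (θ ⟨x, hx⟩ : H) :=
          congrArg Subtype.val (θ.map_smul ⟨act f, act_mem f⟩ ⟨x, hx⟩)
        have h2 : (θ ⟨f g • x, S.smul_mem _ hx⟩ : H) = f g • (θ ⟨x, hx⟩ : H) :=
          congrArg Subtype.val (θ.map_smul (algebraMap k (actAlgebra k H) (f g)) ⟨x, hx⟩)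
        obtain ⟨c, hc⟩ := Submodule.mem_span_singleton.1 (show (θ ⟨x, hx⟩ : H) ∈ _ from
            (θ ⟨x, hx⟩).2)
        rw [← hc, map_smul, act_grouplike hg, smul_comm, hc, ← h2] at h1
        exact congrArg Subtype.val (θ.injective (Subtype.ext h1))
      refine Submodule.mem_span_singleton.2 ⟨Coalgebra.counit (R := k) x, ?_⟩
      refine eq_of_dual (k := k) fun f => ?_
      have := congrArg (Coalgebra.counit (R := k)) (hx1 f)
      rw [counit_act] at this
      simp [this, mul_comm]
    exact (isSimpleRC_line hg).2.2 S key hS.1 hS.2.1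
  · right
    exact ⟨i.pos, by rw [θk.finrank_eq, finrank_row (he i) j]⟩

end Classification

lemma finrank_map_add_finrank_inf_ker {k H : Type*} [Field k] [AddCommGroup H] [Module k H]
    [FiniteDimensional k H] (M : Submodule k H) (T : H →ₗ[k] H) :
    finrank k (M.map T) + finrank k (M ⊓ LinearMap.ker T : Submodule k H) = finrank k M := by
  have h := (T.domRestrict M).finrank_range_add_finrank_ker
  rwa [LinearMap.range_domRestrict, LinearMap.ker_domRestrict, ← Submodule.finrank_map_subtype_eq,
    Submodule.map_comap_subtype] at h

section Coverings

variable {k H : Type*} [Field k] [AddCommGroup H] [Module k H] [Coalgebra k H]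

lemma coact_eq_zero_of_le_ker {X : Submodule k H} (hX : IsRC X) {φ : Dual k H}
    (h : X ≤ LinearMap.ker φ) {x : H} (hx : x ∈ X) : coact φ x = 0 := by
  refine eq_of_dual (k := k) fun f => ?_
  rw [← apply_act, map_zero]
  exact h (hX f x hx)

variable [FiniteDimensional k H] {p t : ℕ} {C : Fin t → Submodule k H}

lemma finrank_of_covering (hC : ∀ i, IsMatrixSubcoalg k H p (C i))
    (hsup : coradical k H = Submodule.span k (grouplikes k H) ⊔ ⨆ i, C i)
    {X M : Submodule k H} (hX : IsRC X) (hM : IsRC M) (hlt : X < M)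
    (hcov : ∀ Y, IsRC Y → X ≤ Y → Y ≤ M → Y = X ∨ Y = M) :
    finrank k M = finrank k X + p ∨
      ∃ g ∈ grouplikes k H, ∀ (f : Dual k H), ∀ m ∈ M, act f m - f g • m ∈ X := by
  obtain ⟨m₀, hm₀, hm₀X⟩ := SetLike.exists_of_lt hlt
  obtain ⟨φ, hφ, hφX⟩ := Submodule.exists_le_ker_of_notMem hm₀X
  have hφm : coact φ m₀ ≠ 0 := by
    intro h
    rw [← counit_coact, h, map_zero] at hφ
    exact hφ rfl
  have hker : M ⊓ LinearMap.ker (coact φ) = X := by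
    refine (hcov _ (hM.inf (isRC_ker_coact φ)) (le_inf hlt.le fun x hx =>
      coact_eq_zero_of_le_ker hX hφX hx) inf_le_left).resolve_right fun h => ?_
    have : m₀ ∈ M ⊓ LinearMap.ker (coact φ) := h.symm ▸ hm₀
    exact hφm this.2
  have hS : IsSimpleRC (M.map (coact φ)) := by
    refine ⟨hM.map_coact φ, fun h => hφm ?_, fun Y hle hY hne => ?_⟩
    · rw [← Submodule.mem_bot k, ← h]
      exact ⟨m₀, hm₀, rfl⟩
    · rcases hcov (M ⊓ Y.comap (coact φ)) (hM.inf (hY.comap_coact φ)) (le_inf hlt.le fun x hx => by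
        rw [Submodule.mem_comap, coact_eq_zero_of_le_ker hX hφX hx]; exact Y.zero_mem)
        inf_le_left with h | h
      · exfalso
        obtain ⟨y, hy, hy0⟩ := Submodule.exists_mem_ne_zero_of_ne_bot hne
        obtain ⟨m, hm, rfl⟩ := hle hy
        have : m ∈ X := h ▸ ⟨hm, hy⟩
        exact hy0 (coact_eq_zero_of_le_ker hX hφX this)
      · refine le_antisymm hle ?_
        rintro _ ⟨m, hm, rfl⟩
        have : m ∈ M ⊓ Y.comap (coact φ) := h.symm ▸ hm
        exact this.2
  rcases hS.eq_line_or hC hsup with ⟨g, hg, h⟩ | ⟨-, h⟩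
  · right
    refine ⟨g, hg, fun f m hm => ?_⟩
    rw [← hker]
    refine ⟨M.sub_mem (hM f m hm) (M.smul_mem _ hm), ?_⟩
    have : coact φ m ∈ M.map (coact φ) := ⟨m, hm, rfl⟩
    rw [h] at this
    obtain ⟨c, hc⟩ := Submodule.mem_span_singleton.1 this
    change coact φ _ = 0
    rw [map_sub, map_smul, ← act_coact, ← hc, map_smul, act_grouplike hg,
      smul_comm, sub_self]
  · left
    rw [← finrank_map_add_finrank_inf_ker M (coact φ), h, hker, add_comm]

lemma pos_of_not_isPointed (hC : ∀ i, IsMatrixSubcoalg k H p (C i))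
    (hsup : coradical k H = Submodule.span k (grouplikes k H) ⊔ ⨆ i, C i)
    (hnp : ¬ IsPointed k H) : 0 < t := by
  by_contra ht
  refine hnp fun D hD => ?_
  obtain ⟨S, hSD, hS⟩ := exists_simpleRC (act_mem_of_isSubcoalg hD.1) hD.2.1
  obtain ⟨g, hg, rfl⟩ := (hS.eq_line_or hC hsup).resolve_right fun h => ht h.1
  have h1 : IsSubcoalgWrt k (comulL k H) (Submodule.span k {g}) := by
    refine isSubcoalg_of_stable hS.1 fun f x hx => ?_
    obtain ⟨c, rfl⟩ := Submodule.mem_span_singleton.1 hx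
    rw [map_smul, coact_grouplike hg]
    exact Submodule.smul_mem _ _ (Submodule.smul_mem _ _ (Submodule.mem_span_singleton_self g))
  have h2 : Submodule.span k {g} = D := by
    by_contra hne
    exact hS.2.1 (hD.2.2 _ h1 (lt_of_le_of_ne hSD hne))
  rw [← h2, finrank_span_singleton hg.1]

end Coverings

section Comatrix

variable {k H : Type*} [Field k] [AddCommGroup H] [Module k H] [Coalgebra k H]
  {ι : Type*} [Fintype ι]

variable (k) in
/-- `c` is a matrix of coefficients of the right coideal spanned by the family `b`. -/
structure IsComatrix (b : ι → H) (c : Matrix ι ι H) : Prop where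
  comul (i j) : comulL k H (c i j) = ∑ l, c i l ⊗ₜ[k] c l j
  counit_same (i) : Coalgebra.counit (R := k) (c i i) = 1
  counit_ne (i j) : i ≠ j → Coalgebra.counit (R := k) (c i j) = 0
  act_eq (f : Dual k H) (j) : act f (b j) = ∑ i, f (c i j) • b i
  apply_eq (T : Module.End k H) (M : Matrix ι ι k) : T ∈ actAlgebra k H →
    (∀ j, T (b j) = ∑ i, M i j • b i) → ∀ i j, T (c i j) = ∑ l, M l j • c i l

lemma exists_comatrix [FiniteDimensional k H] {b : ι → H} (hb : LinearIndependent k b)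
    (hX : IsRC (Submodule.span k (Set.range b))) :
    ∃ c : Matrix ι ι H, IsComatrix k b c := by
  classical
  have hβ : ∀ i, ∃ β : Dual k H, ∀ j, β (b j) = if i = j then 1 else 0 := by
    intro i
    obtain ⟨f, hf⟩ := LinearMap.exists_extend ((Basis.span hb).coord i)
    refine ⟨f, fun j => ?_⟩
    have h1 := LinearMap.congr_fun hf (Basis.span hb j)
    simp only [LinearMap.comp_apply, Basis.coord_apply, Basis.repr_self,
      Finsupp.single_apply] at h1
    rw [Submodule.subtype_apply, Basis.span_apply] at h1
    rw [h1]
    simp [eq_comm]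
  choose β hβ using hβ
  have hexp : ∀ x ∈ Submodule.span k (Set.range b), x = ∑ i, β i x • b i := by
    intro x hx
    obtain ⟨c, rfl⟩ := (Submodule.mem_span_range_iff_exists_fun k).1 hx
    simp [hβ]
  have hact : ∀ (f : Dual k H) j, act f (b j) = ∑ i, f (coact (β i) (b j)) • b i := by
    intro f j
    rw [hexp _ (hX f _ (Submodule.subset_span ⟨j, rfl⟩))]
    simp [apply_act]
  have happ : ∀ (T : Module.End k H) (M : Matrix ι ι k), T ∈ actAlgebra k H →
      (∀ j, T (b j) = ∑ i, M i j • b i) →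
      ∀ i j, T (coact (β i) (b j)) = ∑ l, M l j • coact (β i) (b l) := by
    intro T M hT hM i j
    rw [mem_actAlgebra.1 hT, hM]
    simp
  refine ⟨fun i j => coact (β i) (b j), ⟨fun i j => ?_, fun i => ?_, fun i j hij => ?_,
    hact, happ⟩⟩
  · rw [comul_eq_sum_act (finBasis k H)]
    have : ∀ m, act ((finBasis k H).coord m) (coact (β i) (b j)) =
        ∑ l, (finBasis k H).coord m (coact (β l) (b j)) • coact (β i) (b l) :=
      fun m => happ _ (fun l j => (finBasis k H).coord m (coact (β l) (b j)))
        (act_mem _) (hact _) i j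
    simp_rw [this, TensorProduct.sum_tmul, ← TensorProduct.smul_tmul']
    rw [Finset.sum_comm]
    refine Finset.sum_congr rfl fun l _ => ?_
    simp_rw [← TensorProduct.tmul_smul, ← TensorProduct.tmul_sum]
    congr 1
    exact (finBasis k H).sum_repr _
  · simp [counit_coact, hβ]
  · simp [counit_coact, hβ, hij]

end Comatrix

section Hopf

variable {k H : Type*} [Field k] [Ring H] [HopfAlgebra k H]

lemma IsComatrix.mul_antipode {ι : Type*} [Fintype ι] [DecidableEq ι] {b : ι → H}
    {c : Matrix ι ι H} (hc : IsComatrix k b c) : c * c.map (HopfAlgebra.antipode k) = 1 := by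
  ext i j
  have h := HopfAlgebra.mul_antipode_lTensor_comul_apply (R := k) (c i j)
  rw [show CoalgebraStruct.comul (R := k) (c i j) = _ from hc.comul i j] at h
  simp only [map_sum, LinearMap.lTensor_tmul, LinearMap.mul'_apply] at h
  rw [Matrix.mul_apply]
  simp only [Matrix.map_apply]
  rw [h]
  rcases eq_or_ne i j with rfl | hij
  · simp [hc.counit_same]
  · simp [hc.counit_ne i j hij, hij]

lemma IsComatrix.antipode_mul {ι : Type*} [Fintype ι] [DecidableEq ι] {b : ι → H}
    {c : Matrix ι ι H} (hc : IsComatrix k b c) : c.map (HopfAlgebra.antipode k) * c = 1 := by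
  ext i j
  have h := HopfAlgebra.mul_antipode_rTensor_comul_apply (R := k) (c i j)
  rw [show CoalgebraStruct.comul (R := k) (c i j) = _ from hc.comul i j] at h
  simp only [map_sum, LinearMap.rTensor_tmul, LinearMap.mul'_apply] at h
  rw [Matrix.mul_apply]
  simp only [Matrix.map_apply]
  rw [h]
  rcases eq_or_ne i j with rfl | hij
  · simp [hc.counit_same]
  · simp [hc.counit_ne i j hij, hij]

lemma act_mul {κ : Type*} {s : Finset κ} {u v : κ → Dual k H} {f : Dual k H}
    (hf : ∀ a b, f (a * b) = ∑ i ∈ s, u i a * v i b) (a b : H) :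
    act f (a * b) = ∑ i ∈ s, act (u i) a * act (v i) b := by
  let ra := Coalgebra.Repr.arbitrary k a
  let rb := Coalgebra.Repr.arbitrary k b
  have h : comulL k H (a * b) = ∑ x ∈ ra.index ×ˢ rb.index,
      (ra.left x.1 * rb.left x.2) ⊗ₜ[k] (ra.right x.1 * rb.right x.2) := by
    rw [comulL, Bialgebra.comul_mul, ← ra.eq, ← rb.eq, Finset.sum_mul_sum, Finset.sum_product]
    simp
  rw [act_eq_sum h]
  simp_rw [act_repr ra, act_repr rb, Finset.sum_mul_sum, hf, Finset.sum_smul]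
  rw [Finset.sum_comm]
  refine Finset.sum_congr rfl fun i _ => ?_
  rw [Finset.sum_product]
  refine Finset.sum_congr rfl fun x _ => Finset.sum_congr rfl fun y _ => ?_
  rw [smul_mul_smul_comm]

lemma act_antipode_act {h : Dual k H} (h1 : h 1 = 1) (hm : ∀ a b, h (a * b) = h a * h b) (a : H) :
    act (h ∘ₗ HopfAlgebra.antipode k) (act h a) = a := by
  have hT : (act (h ∘ₗ HopfAlgebra.antipode k) ∘ₗ act h : H →ₗ[k] H) = act _ :=
    eq_act fun f x => by simp [act_coact]
  have he : (Coalgebra.counit (R := k) ∘ₗ (act (h ∘ₗ HopfAlgebra.antipode k) ∘ₗ act h :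
      H →ₗ[k] H)) = Coalgebra.counit (R := k) := by
    ext x
    let r := Coalgebra.Repr.arbitrary k x
    have h2 := congrArg h (HopfAlgebra.sum_antipode_mul_eq_algebraMap_counit r)
    rw [Algebra.algebraMap_eq_smul_one, map_smul, h1, smul_eq_mul, mul_one, map_sum] at h2
    simp only [LinearMap.comp_apply, counit_act]
    rw [act_repr r]
    simp only [map_sum, map_smul, smul_eq_mul, ← h2, hm]
    exact Finset.sum_congr rfl fun _ _ => mul_comm _ _
  rw [← LinearMap.comp_apply, hT, he, act_counit]

end Hopf

lemma iSup_eigenspace_of_pow_eq_one {k V : Type*} [Field k] [IsAlgClosed k] [CharZero k]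
    [AddCommGroup V] [Module k V] [FiniteDimensional k V] {T : End k V} {n : ℕ} (hn : 0 < n)
    (hT : T ^ n = 1) : ⨆ μ : k, End.eigenspace T μ = ⊤ := by
  refine End.IsSemisimple.iSup_eigenspace_eq_top
    (End.isSemisimple_of_squarefree_aeval_eq_zero (p := Polynomial.X ^ n - 1) ?_ ?_)
  · exact (Polynomial.X_pow_sub_one_separable_iff.2 (by exact_mod_cast hn.ne')).squarefree
  · simp [hT]

lemma exists_eigenvector_notMem {k V : Type*} [Field k] [IsAlgClosed k] [CharZero k]
    [AddCommGroup V] [Module k V] [FiniteDimensional k V] {T : End k V} {n : ℕ} (hn : 0 < n)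
    (hT : T ^ n = 1) {W N : Submodule k V} (hW : ∀ x ∈ W, T x ∈ W) (h : ¬ W ≤ N) :
    ∃ (μ : k) (x : V), x ∈ W ∧ x ∉ N ∧ T x = μ • x := by
  by_contra! hcon
  apply h
  have hTW : (T.restrict hW) ^ n = 1 := by
    ext x
    rw [Module.End.pow_restrict (h := hW)]
    simp [LinearMap.restrict_apply, hT]
  have htop := iSup_eigenspace_of_pow_eq_one hn hTW
  have hle : (⨆ μ : k, End.eigenspace (T.restrict hW) μ) ≤ N.comap W.subtype := by
    refine iSup_le fun μ x hx => ?_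
    rw [End.mem_eigenspace_iff] at hx
    by_contra hxN
    exact hcon μ x x.2 hxN (congrArg Subtype.val hx)
  intro x hx
  have : (⟨x, hx⟩ : W) ∈ (⊤ : Submodule k W) := trivial
  rw [← htop] at this
  exact hle this

lemma pow_eq_one_of_eigenvector {k V : Type*} [Field k] [AddCommGroup V] [Module k V]
    {T : End k V} {n : ℕ} (hT : T ^ n = 1) {μ : k} {x : V} (hx : T x = μ • x) (h0 : x ≠ 0) :
    μ ^ n = 1 := by
  have h : ∀ m : ℕ, (T ^ m) x = μ ^ m • x := by
    intro m
    induction m with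
    | zero => simp
    | succ m ih => rw [pow_succ', Module.End.mul_apply, ih, map_smul, hx, smul_smul, pow_succ]
  have h1 := h n
  rw [hT, Module.End.one_apply] at h1
  exact smul_left_injective k h0 (by simpa using h1.symm)

section Skew

variable {k H : Type*} [Field k] [Ring H] [HopfAlgebra k H]

/-- Algebra automorphisms of finite order commuting with the operators `coact f`. -/
structure IsAut (σ : End k H) : Prop where
  mem : σ ∈ actAlgebra k H
  one : σ 1 = 1
  mul (a b : H) : σ (a * b) = σ a * σ b
  fin : IsOfFinOrder σ

lemma counit_pow_eq {σ τ : End k H} (hσ : σ ∈ actAlgebra k H) (hτ : τ ∈ actAlgebra k H)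
    (h : Coalgebra.counit (R := k) ∘ₗ σ = Coalgebra.counit (R := k) ∘ₗ τ) : σ = τ := by
  rw [eq_act (mem_actAlgebra.1 hσ), h, ← eq_act (mem_actAlgebra.1 hτ)]

lemma pow_mul_apply {σ : End k H} (hm : ∀ a b, σ (a * b) = σ a * σ b) (n : ℕ) (a b : H) :
    (σ ^ n) (a * b) = (σ ^ n) a * (σ ^ n) b := by
  induction n with
  | zero => simp
  | succ n ih => rw [pow_succ', End.mul_apply, ih, hm]; rfl

lemma pow_one_apply {σ : End k H} (h1 : σ 1 = 1) (n : ℕ) : (σ ^ n) 1 = 1 := by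
  induction n with
  | zero => simp
  | succ n ih => rw [pow_succ', End.mul_apply, ih, h1]

/-- Dedekind's lemma for the characters `ε ∘ σ ^ i`. -/
lemma linearIndependent_counit_pow {σ : End k H} (hσ : σ ∈ actAlgebra k H) (h1 : σ 1 = 1)
    (hm : ∀ a b, σ (a * b) = σ a * σ b) {ι : Type*} {e : ι → ℕ}
    (he : Function.Injective fun i => σ ^ e i) :
    LinearIndependent k fun i => (Coalgebra.counit (R := k) ∘ₗ (σ ^ e i) : Dual k H) := by
  let χ : ι → (H →* k) := fun i =>
    { toFun := fun a => Coalgebra.counit (R := k) ((σ ^ e i) a)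
      map_one' := by rw [pow_one_apply h1, Bialgebra.counit_one]
      map_mul' := fun a b => by rw [pow_mul_apply hm, Bialgebra.counit_mul] }
  have hχ : Function.Injective χ := by
    intro i j hij
    refine he (counit_pow_eq (pow_mem hσ _) (pow_mem hσ _) (LinearMap.ext fun a => ?_))
    exact DFunLike.congr_fun hij a
  have h := (linearIndependent_monoidHom H k).comp χ hχ
  exact LinearIndependent.of_comp (LinearMap.ltoFun k H k k) h

lemma IsAut.mk' [FiniteDimensional k H] {σ : End k H} (hσ : σ ∈ actAlgebra k H) (h1 : σ 1 = 1)
    (hm : ∀ a b, σ (a * b) = σ a * σ b) (hinj : Function.Injective σ) : IsAut σ := by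
  refine ⟨hσ, h1, hm, ?_⟩
  by_contra hfin
  have hunit : IsUnit σ := (LinearMap.isUnit_iff_ker_eq_bot σ).2 (LinearMap.ker_eq_bot.2 hinj)
  obtain ⟨u, rfl⟩ := hunit
  rw [Units.isOfFinOrder_val] at hfin
  have hpow := injective_pow_iff_not_isOfFinOrder.2 hfin
  have h := linearIndependent_counit_pow hσ h1 hm (ι := Fin (finrank k (Dual k H) + 1))
    (e := Fin.val) (fun i j hij => Fin.ext (hpow (Units.ext (by simpa using hij))))
  have := h.fintype_card_le_finrank
  simp at this

/-- `D` is a `(σ, 1)`-derivation commuting with the operators `coact f`. -/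
structure IsSkewDer (σ D : End k H) : Prop where
  mem : D ∈ actAlgebra k H
  leibniz (a b : H) : D (a * b) = σ a * D b + D a * b

lemma dualDistrib_dualComul [FiniteDimensional k H] (f : Dual k H) (a b : H) :
    TensorProduct.dualDistrib k H H (dualComul k H f) (a ⊗ₜ b) = f (a * b) := by
  have h : (TensorProduct.dualDistribEquiv k H H) (dualComul k H f) =
      (LinearMap.mul' k H).dualMap f := by
    rw [dualComul, LinearMap.comp_apply, LinearEquiv.coe_coe, LinearEquiv.apply_symm_apply]
  have h2 := LinearMap.congr_fun h (a ⊗ₜ b)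
  rw [LinearMap.dualMap_apply, LinearMap.mul'_apply] at h2
  rw [← h2]
  rfl

lemma apply_mul_of_isGrouplike [FiniteDimensional k H] {g : Dual k H}
    (hg : IsGrouplikeWrt k (dualComul k H) g) (a b : H) : g (a * b) = g a * g b := by
  rw [← dualDistrib_dualComul, hg.2]
  simp

lemma apply_one_of_isGrouplike [FiniteDimensional k H] {g : Dual k H}
    (hg : IsGrouplikeWrt k (dualComul k H) g) : g 1 = 1 := by
  obtain ⟨a, ha⟩ : ∃ a, g a ≠ 0 := by
    by_contra! h
    exact hg.1 (LinearMap.ext h)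
  have := apply_mul_of_isGrouplike hg a 1
  rw [mul_one] at this
  exact mul_left_cancel₀ ha (by rw [← this, mul_one])

lemma exists_skewDer [FiniteDimensional k H]
    (hH : ¬ HasNoNontrivialSkewPrimitivesWrt k (dualComul k H)) :
    ∃ σ D : End k H, IsAut σ ∧ IsSkewDer σ D ∧ ∀ c : k, D ≠ c • (σ - 1) := by
  simp only [HasNoNontrivialSkewPrimitivesWrt] at hH
  push Not at hH
  obtain ⟨g, h, y, hg, hh, hy, hne⟩ := hH
  have hg1 := apply_one_of_isGrouplike hg
  have hh1 := apply_one_of_isGrouplike hh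
  have hgm := apply_mul_of_isGrouplike hg
  have hhm := apply_mul_of_isGrouplike hh
  have hym : ∀ a b, y (a * b) = g a * y b + y a * h b := by
    intro a b
    rw [← dualDistrib_dualComul, hy, map_add]
    simp
  have hact1 : ∀ {f : Dual k H}, f 1 = 1 → act f (1 : H) = 1 := by
    intro f hf
    have : comulL k H 1 = 1 ⊗ₜ[k] 1 := by
      rw [comulL, Bialgebra.comul_one, Algebra.TensorProduct.one_def]
    simp [act, this, hf]
  have hactm : ∀ {f : Dual k H}, (∀ a b, f (a * b) = f a * f b) → ∀ a b : H,
      act f (a * b) = act f a * act f b := by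
    intro f hf a b
    have := act_mul (s := {()}) (u := fun _ => f) (v := fun _ => f) (f := f) (by simpa using hf) a b
    simpa using this
  have hactinj : ∀ {f : Dual k H}, f 1 = 1 → (∀ a b, f (a * b) = f a * f b) →
      Function.Injective (act f) := fun h1 hm =>
    Function.LeftInverse.injective (act_antipode_act h1 hm)
  have hyact : ∀ a b, act y (a * b) = act g a * act y b + act y a * act h b := by
    intro a b
    have := act_mul (s := Finset.univ) (u := ![g, y]) (v := ![y, h]) (f := y)
      (by simpa [Fin.sum_univ_two] using hym) a b
    simpa [Fin.sum_univ_two] using this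
  have hunit : IsUnit (act h : End k H) :=
    (LinearMap.isUnit_iff_ker_eq_bot _).2 (LinearMap.ker_eq_bot.2 (hactinj hh1 hhm))
  obtain ⟨u, hu⟩ := hunit
  set τ : End k H := ↑u⁻¹ with hτ
  have hτ1 : act h * τ = 1 := by rw [← hu]; simp [hτ]
  have hτ2 : τ * act h = 1 := by rw [← hu]; simp [hτ]
  have e1 : ∀ x, act h (τ x) = x := fun x => LinearMap.congr_fun hτ1 x
  have e2 : ∀ x, τ (act h x) = x := fun x => LinearMap.congr_fun hτ2 x
  have hτmem : τ ∈ actAlgebra k H := by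
    refine mem_actAlgebra.2 fun f x => ?_
    conv_lhs => rw [← e1 x, ← act_coact, e2]
  have hτone : τ 1 = 1 := by simpa [hact1 hh1] using e2 1
  have hτmul : ∀ a b, τ (a * b) = τ a * τ b := by
    intro a b
    conv_lhs => rw [← e1 a, ← e1 b, ← hactm hhm, e2]
  refine ⟨act g * τ, act y * τ, IsAut.mk' (mul_mem (act_mem g) hτmem) ?_ ?_ ?_,
    ⟨mul_mem (act_mem y) hτmem, ?_⟩, ?_⟩
  · simp [hτone, hact1 hg1]
  · intro a b; simp [hτmul, hactm hgm]
  · exact (hactinj hg1 hgm).comp (Function.LeftInverse.injective e1)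
  · intro a b
    simp only [End.mul_apply, hτmul, hyact, e1]
  · intro c hc
    refine hne c (LinearMap.ext fun x => ?_)
    have := congrArg (Coalgebra.counit (R := k)) (LinearMap.congr_fun hc (act h x))
    simp only [End.mul_apply, e2, LinearMap.smul_apply, LinearMap.sub_apply, End.one_apply,
      map_smul, map_sub, counit_act] at this
    simpa using this

variable [IsAlgClosed k] [CharZero k] [FiniteDimensional k H]

lemma exists_eigen_skewDer {σ D : End k H} (hσ : IsAut σ) (hD : IsSkewDer σ D)
    (hne : ∀ c : k, D ≠ c • (σ - 1)) :
    ∃ (D' : End k H) (q : k), IsSkewDer σ D' ∧ (∀ c : k, D' ≠ c • (σ - 1)) ∧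
      ∀ x, σ (D' x) = q • D' (σ x) := by
  have hr := hσ.fin.orderOf_pos
  have hpow := pow_orderOf_eq_one σ
  set r := orderOf σ
  have hσσ : σ * σ ^ (r - 1) = 1 := by rw [← pow_succ', Nat.sub_add_cancel hr, hpow]
  have hσσ' : ∀ x, σ ((σ ^ (r - 1)) x) = x := fun x => LinearMap.congr_fun hσσ x
  let W : Submodule k (H →ₗ[k] H) :=
    { carrier := {D | IsSkewDer σ D}
      add_mem' := fun {A B} hA hB => ⟨add_mem hA.mem hB.mem, fun a b => by
        simp only [LinearMap.add_apply, hA.leibniz, hB.leibniz, mul_add, add_mul]; abel⟩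
      zero_mem' := ⟨zero_mem _, fun a b => by simp⟩
      smul_mem' := fun c A hA => ⟨Subalgebra.smul_mem _ hA.mem c, fun a b => by
        simp only [LinearMap.smul_apply, hA.leibniz, smul_add, mul_smul_comm, smul_mul_assoc]⟩ }
  let Φ : End k (H →ₗ[k] H) :=
    LinearMap.mulLeft k (σ : End k H) ∘ₗ LinearMap.mulRight k (σ ^ (r - 1) : End k H)
  have hΦ1 : ∀ A, Φ A = σ * A * σ ^ (r - 1) := fun A => rfl
  have hΦ : ∀ (n : ℕ) (A : H →ₗ[k] H), (Φ ^ n) A = σ ^ n * A * (σ ^ (r - 1)) ^ n := by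
    intro n A
    induction n with
    | zero => rfl
    | succ n ih =>
      rw [pow_succ', End.mul_apply, hΦ1, ih, pow_succ' σ, pow_succ (σ ^ (r - 1))]
      simp only [mul_assoc]
  have hΦr : Φ ^ r = 1 := by
    refine LinearMap.ext fun A => ?_
    rw [hΦ, hpow, ← pow_mul, mul_comm, pow_mul, hpow, one_pow, one_mul, mul_one]
    rfl
  have hW : ∀ A ∈ W, Φ A ∈ W := fun A hA =>
    ⟨hΦ1 A ▸ mul_mem (mul_mem hσ.mem hA.mem) (pow_mem hσ.mem _), fun a b => by
      simp only [hΦ1, End.mul_apply, pow_mul_apply hσ.mul, hA.leibniz, map_add, hσ.mul, hσσ']⟩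
  have hWN : ¬ W ≤ Submodule.span k {(σ - 1 : H →ₗ[k] H)} := fun h => by
    obtain ⟨c, hc⟩ := Submodule.mem_span_singleton.1 (h (show D ∈ W from hD))
    exact hne c hc.symm
  obtain ⟨μ, A, hAW, hAN, hA⟩ := exists_eigenvector_notMem hr hΦr hW hWN
  refine ⟨A, μ, hAW, fun c hc => hAN (Submodule.mem_span_singleton.2 ⟨c, hc.symm⟩), fun x => ?_⟩
  have h2 : σ (A ((σ ^ (r - 1)) (σ x))) = μ • A (σ x) := LinearMap.congr_fun hA (σ x)
  have h3 : (σ ^ (r - 1)) (σ x) = x := by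
    have : σ ^ (r - 1) * σ = 1 := by rw [← pow_succ, Nat.sub_add_cancel hr, hpow]
    exact LinearMap.congr_fun this x
  rwa [h3] at h2

end Skew

section Gauss

variable {k : Type*} [Field k]

/-- Gaussian binomial coefficients, defined by the `κ`-Pascal rule. -/
def gauss (κ : k) : ℕ → ℕ → k
  | _, 0 => 1
  | 0, _ + 1 => 0
  | m + 1, s + 1 => gauss κ m s + κ ^ (s + 1) * gauss κ m (s + 1)

@[simp] lemma gauss_zero_right (κ : k) (m : ℕ) : gauss κ m 0 = 1 := by
  cases m <;> rfl

lemma gauss_succ_succ (κ : k) (m s : ℕ) :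
    gauss κ (m + 1) (s + 1) = gauss κ m s + κ ^ (s + 1) * gauss κ m (s + 1) := rfl

lemma gauss_eq_zero_of_lt (κ : k) : ∀ {m s : ℕ}, m < s → gauss κ m s = 0
  | _, 0, h => absurd h (Nat.not_lt_zero _)
  | 0, _ + 1, _ => rfl
  | m + 1, s + 1, h => by
    rw [gauss_succ_succ, gauss_eq_zero_of_lt κ (Nat.lt_of_succ_lt_succ h),
      gauss_eq_zero_of_lt κ (m := m) (by omega)]
    ring

lemma gauss_self (κ : k) (m : ℕ) : gauss κ m m = 1 := by
  induction m with
  | zero => rfl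
  | succ m ih =>
    rw [gauss_succ_succ, ih, gauss_eq_zero_of_lt κ (Nat.lt_succ_self m)]
    ring

lemma gauss_succ_self (κ : k) (m : ℕ) :
    gauss κ (m + 1) m = ∑ i ∈ Finset.range (m + 1), κ ^ i := by
  induction m with
  | zero => simp
  | succ m ih => rw [gauss_succ_succ, ih, gauss_self, Finset.sum_range_succ _ (m + 1), mul_one]

lemma gauss_absorption (κ : k) (m s : ℕ) :
    (κ ^ (s + 1) - 1) * gauss κ (m + 1) (s + 1) = (κ ^ (m + 1) - 1) * gauss κ m s := by
  induction m generalizing s with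
  | zero =>
    cases s with
    | zero => simp [gauss]
    | succ s => simp [gauss]
  | succ m ih =>
    have key : κ ^ s * (κ ^ (m + 1) - 1) * gauss κ m s =
        (κ ^ (m + 1) - κ ^ s) * gauss κ (m + 1) s := by
      cases s with
      | zero => simp
      | succ s =>
        have h1 := ih s
        have h2 := gauss_succ_succ κ m s
        linear_combination (κ ^ (m + 1) - 1) * h2.symm + h1
    rw [gauss_succ_succ]
    linear_combination κ ^ (s + 1) * ih s + κ * key

lemma gauss_eq_zero_of_isPrimitiveRoot {κ : k} {p : ℕ} (hκ : IsPrimitiveRoot κ p) {s : ℕ}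
    (h0 : 0 < s) (hs : s < p) : gauss κ p s = 0 := by
  obtain ⟨s, rfl⟩ := Nat.exists_eq_succ_of_ne_zero h0.ne'
  obtain ⟨p, rfl⟩ := Nat.exists_eq_succ_of_ne_zero (by omega : p ≠ 0)
  have h := gauss_absorption κ p s
  rw [hκ.pow_eq_one, sub_self, zero_mul] at h
  refine (mul_eq_zero.1 h).resolve_left (sub_ne_zero.2 fun h1 => ?_)
  exact absurd (Nat.le_of_dvd h0 (hκ.dvd_of_pow_eq_one _ h1)) (by omega)

end Gauss

section Independence

variable {k H : Type*} [Field k] [Ring H] [HopfAlgebra k H]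

lemma exists_dual_vector {V ι : Type*} [AddCommGroup V] [Module k V] [FiniteDimensional k V]
    [DecidableEq ι] {ψ : ι → Dual k V} (hψ : LinearIndependent k ψ) (i₀ : ι) :
    ∃ b : V, ∀ i, ψ i b = if i = i₀ then 1 else 0 := by
  obtain ⟨F, hF⟩ := LinearMap.exists_extend
    (p := Submodule.span k (Set.range ψ)) ((Finsupp.lapply i₀ : (ι →₀ k) →ₗ[k] k) ∘ₗ hψ.repr)
  refine ⟨(evalEquiv k V).symm F, fun i => ?_⟩
  rw [apply_evalEquiv_symm_apply]
  have h := LinearMap.congr_fun hF ⟨ψ i, Submodule.subset_span ⟨i, rfl⟩⟩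
  have h2 : hψ.repr ⟨ψ i, Submodule.subset_span ⟨i, rfl⟩⟩ = Finsupp.single i 1 :=
    hψ.repr_eq_single i _ rfl
  rw [LinearMap.comp_apply, LinearMap.comp_apply, h2, Finsupp.lapply_apply,
    Finsupp.single_apply] at h
  exact h

variable {σ D : End k H} {κ : k}

lemma IsSkewDer.apply_one (hD : IsSkewDer σ D) (h1 : σ 1 = 1) : D 1 = 0 := by
  have h := hD.leibniz 1 1
  rw [mul_one, h1, one_mul, mul_one] at h
  exact left_eq_add.1 h

lemma apply_pow_of_skew_comm (hκ : ∀ x, D (σ x) = κ • σ (D x)) (s : ℕ) (x : H) :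
    D ((σ ^ s) x) = κ ^ s • (σ ^ s) (D x) := by
  induction s with
  | zero => simp
  | succ s ih =>
    rw [pow_succ', End.mul_apply, hκ, ih, map_smul, smul_smul, pow_succ' κ, End.mul_apply]

/-- The `κ`-Leibniz rule. -/
lemma IsSkewDer.pow_apply_mul (hD : IsSkewDer σ D) (hκ : ∀ x, D (σ x) = κ • σ (D x))
    (m : ℕ) (a b : H) : (D ^ m) (a * b) = ∑ s ∈ Finset.range (m + 1),
      gauss κ m s • ((σ ^ s) ((D ^ (m - s)) a) * (D ^ s) b) := by
  induction m with
  | zero => simp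
  | succ m ih =>
    have e1 : ∀ s ∈ Finset.range (m + 1),
        D (gauss κ m s • ((σ ^ s) ((D ^ (m - s)) a) * (D ^ s) b)) =
        gauss κ m s • ((σ ^ (s + 1)) ((D ^ (m - s)) a) * (D ^ (s + 1)) b) +
        (κ ^ s * gauss κ m s) • ((σ ^ s) ((D ^ (m + 1 - s)) a) * (D ^ s) b) := by
      intro s hs
      have hs' : m + 1 - s = (m - s) + 1 := by have := Finset.mem_range.1 hs; omega
      rw [map_smul, hD.leibniz, apply_pow_of_skew_comm hκ, smul_add, hs', pow_succ' σ,
        pow_succ' D (m - s), pow_succ' D s, smul_mul_assoc, smul_smul, mul_comm (κ ^ s)]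
      rfl
    rw [pow_succ', End.mul_apply, ih, map_sum, Finset.sum_congr rfl e1, Finset.sum_add_distrib]
    have e2 : ∑ s ∈ Finset.range (m + 1),
        (κ ^ s * gauss κ m s) • ((σ ^ s) ((D ^ (m + 1 - s)) a) * (D ^ s) b) =
        ∑ s ∈ Finset.range (m + 2),
        (κ ^ s * gauss κ m s) • ((σ ^ s) ((D ^ (m + 1 - s)) a) * (D ^ s) b) := by
      rw [Finset.sum_range_succ _ (m + 1), gauss_eq_zero_of_lt κ (Nat.lt_succ_self m)]
      simp
    rw [e2, Finset.sum_range_succ' _ (m + 1), Finset.sum_range_succ' _ (m + 1), ← add_assoc,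
      ← Finset.sum_add_distrib]
    congr 1
    · refine Finset.sum_congr rfl fun s _ => ?_
      rw [gauss_succ_succ, add_smul, Nat.add_sub_add_right]
    · simp

variable (σ D) in
/-- The functional `ε ∘ σ ^ i ∘ D ^ j`. -/
noncomputable def ev (i j : ℕ) : Dual k H := Coalgebra.counit (R := k) ∘ₗ (σ ^ i * D ^ j)

lemma ev_apply_mul (hσm : ∀ a b, σ (a * b) = σ a * σ b) (hD : IsSkewDer σ D)
    (hκ : ∀ x, D (σ x) = κ • σ (D x)) (i m : ℕ) (a b : H) :
    ev σ D i m (a * b) = ∑ s ∈ Finset.range (m + 1),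
      gauss κ m s * (ev σ D (i + s) (m - s) a * ev σ D i s b) := by
  simp only [ev, LinearMap.comp_apply, End.mul_apply, hD.pow_apply_mul hκ, map_sum, map_smul,
    pow_mul_apply hσm, Bialgebra.counit_mul, smul_eq_mul, pow_add]

lemma ev_comp_mulRight (hσm : ∀ a b, σ (a * b) = σ a * σ b) (hD : IsSkewDer σ D)
    (hκ : ∀ x, D (σ x) = κ • σ (D x)) (i m : ℕ) (b : H) :
    ev σ D i m ∘ₗ LinearMap.mulRight k b = ∑ s ∈ Finset.range (m + 1),
      (gauss κ m s * ev σ D i s b) • ev σ D (i + s) (m - s) := by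
  ext a
  rw [LinearMap.comp_apply, LinearMap.mulRight_apply, ev_apply_mul hσm hD hκ,
    LinearMap.sum_apply]
  refine Finset.sum_congr rfl fun s _ => ?_
  rw [LinearMap.smul_apply, smul_eq_mul]
  ring

lemma IsSkewDer.eq_smul_of_mem_span (hσ : IsAut σ) (hD : IsSkewDer σ D)
    (h : D ∈ Submodule.span k (Set.range fun n : ℕ => (σ ^ n : End k H))) :
    ∃ c : k, D = c • (σ - 1) := by
  have hr := hσ.fin.orderOf_pos
  set r := orderOf σ with hrdef
  have hinj : Function.Injective fun i : Fin r => σ ^ (i : ℕ) := fun i j hij =>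
    Fin.ext (pow_injOn_Iio_orderOf i.2 j.2 hij)
  have hα := linearIndependent_counit_pow hσ.mem hσ.one hσ.mul hinj
  have hpm : ∀ n, σ ^ n = σ ^ (n % r) := fun n => (pow_mod_orderOf σ n).symm
  have hrange : Set.range (fun n : ℕ => (σ ^ n : End k H)) =
      Set.range (fun i : Fin r => (σ ^ (i : ℕ) : End k H)) := by
    ext A
    constructor
    · rintro ⟨n, rfl⟩; exact ⟨⟨n % r, Nat.mod_lt _ hr⟩, (hpm n).symm⟩
    · rintro ⟨i, rfl⟩; exact ⟨i, rfl⟩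
  rw [hrange] at h
  obtain ⟨d, hd⟩ := (Submodule.mem_span_range_iff_exists_fun k).1 h
  set α : Fin r → Dual k H := fun i => Coalgebra.counit (R := k) ∘ₗ (σ ^ (i : ℕ)) with hαdef
  let i₁ : Fin r := ⟨1 % r, Nat.mod_lt _ hr⟩
  have hi₁ : σ ^ (i₁ : ℕ) = σ := by rw [← hpm, pow_one]
  have hεD : ∀ x, Coalgebra.counit (R := k) (D x) = ∑ i, d i * α i x := by
    intro x
    rw [← hd]
    simp [hαdef]
  have hz : ∀ i, i ≠ i₁ → d i = 0 ∨ σ ^ (i : ℕ) = 1 := by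
    intro i hi
    by_contra! hcon
    have hne : α i ≠ Coalgebra.counit := by
      intro h
      exact hcon.2 (counit_pow_eq (pow_mem hσ.mem _) (one_mem _) h)
    obtain ⟨b, hb⟩ : ∃ b, α i b ≠ Coalgebra.counit (R := k) b := by
      by_contra! h
      exact hne (LinearMap.ext h)
    have hrel : ∑ j, (d j * (α j b - Coalgebra.counit (R := k) b) -
        if j = i₁ then ∑ l, d l * α l b else 0) • α j = 0 := by
      ext a
      have hl := congrArg (Coalgebra.counit (R := k)) (hD.leibniz a b)
      rw [map_add, Bialgebra.counit_mul, Bialgebra.counit_mul, hεD, hεD, hεD] at hl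
      have hσa : Coalgebra.counit (R := k) (σ a) = α i₁ a := by
        simp only [hαdef, LinearMap.comp_apply, hi₁]
      have hm : ∀ j, α j (a * b) = α j a * α j b := fun j => by
        simp only [hαdef, LinearMap.comp_apply, pow_mul_apply hσ.mul, Bialgebra.counit_mul]
      simp only [hm, hσa] at hl
      simp only [LinearMap.sum_apply, LinearMap.smul_apply, smul_eq_mul, LinearMap.zero_apply,
        sub_mul, ite_mul, zero_mul, Finset.sum_sub_distrib, Finset.sum_ite_eq',
        Finset.mem_univ, if_true, mul_sub]
      rw [Finset.sum_mul] at hl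
      have e1 : ∑ j, d j * α j b * α j a = ∑ j, d j * (α j a * α j b) :=
        Finset.sum_congr rfl fun j _ => by ring
      have e2 : ∑ j, d j * Coalgebra.counit (R := k) b * α j a =
          ∑ j, d j * α j a * Coalgebra.counit (R := k) b :=
        Finset.sum_congr rfl fun j _ => by ring
      rw [e1, e2, hl]
      ring
    have h0 := Fintype.linearIndependent_iff.1 hα _ hrel i
    rw [if_neg hi, sub_zero] at h0
    exact (mul_eq_zero.1 h0).elim hcon.1 (sub_ne_zero.2 hb)
  have hmem : D ∈ Submodule.span k {(1 : End k H), σ} := by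
    rw [← hd]
    refine Submodule.sum_mem _ fun i _ => ?_
    by_cases hi : i = i₁
    · rw [hi, hi₁]
      exact Submodule.smul_mem _ _ (Submodule.subset_span (by simp))
    · rcases hz i hi with h | h
      · rw [h, zero_smul]; exact zero_mem _
      · rw [h]; exact Submodule.smul_mem _ _ (Submodule.subset_span (by simp))
  obtain ⟨x, y, hxy⟩ := Submodule.mem_span_pair.1 hmem
  have h1 := LinearMap.congr_fun hxy 1
  rw [hD.apply_one hσ.one, LinearMap.add_apply, LinearMap.smul_apply, LinearMap.smul_apply,
    hσ.one, End.one_apply, ← add_smul] at h1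
  have h2 := congrArg (Coalgebra.counit (R := k)) h1
  rw [map_smul, Bialgebra.counit_one, map_zero, smul_eq_mul, mul_one] at h2
  refine ⟨y, ?_⟩
  rw [← hxy, eq_neg_of_add_eq_zero_left h2, smul_sub, neg_smul]
  abel

lemma ev_one_notMem_span (hσ : IsAut σ) (hD : IsSkewDer σ D) (hne : ∀ c : k, D ≠ c • (σ - 1))
    (n : ℕ) : ev σ D n 1 ∉ Submodule.span k (Set.range fun m => ev σ D m 0) := by
  intro h
  have hpow := pow_orderOf_eq_one σ
  have hr := hσ.fin.orderOf_pos
  set r := orderOf σ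
  obtain ⟨c, hc⟩ := Finsupp.mem_span_range_iff_exists_finsupp.1 h
  have h1 : (σ ^ n * D : End k H) = c.sum fun m x => x • σ ^ m := by
    refine counit_pow_eq (mul_mem (pow_mem hσ.mem _) hD.mem)
      (sum_mem fun m _ => Subalgebra.smul_mem _ (pow_mem hσ.mem _) _) ?_
    rw [ev, pow_one] at hc
    rw [← hc]
    ext x
    simp [Finsupp.sum, ev]
  have h2 : σ ^ (r * n - n) * σ ^ n = 1 := by
    rw [← pow_add, Nat.sub_add_cancel (Nat.le_mul_of_pos_left n hr), pow_mul, hpow, one_pow]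
  have h3 : D ∈ Submodule.span k (Set.range fun n : ℕ => (σ ^ n : End k H)) := by
    have : D = σ ^ (r * n - n) * (σ ^ n * D) := by rw [← mul_assoc, h2, one_mul]
    rw [this, h1, Finsupp.mul_sum]
    refine sum_mem fun m _ => ?_
    dsimp only
    rw [mul_smul_comm, ← pow_add]
    exact Submodule.smul_mem _ _ (Submodule.subset_span ⟨_, rfl⟩)
  obtain ⟨c, hc⟩ := hD.eq_smul_of_mem_span hσ h3
  exact hne c hc

variable [FiniteDimensional k H]

/-- The functionals `ε ∘ σ ^ i ∘ D ^ j` are linearly independent as long as the relevant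
`κ`-integers do not vanish. -/
lemma linearIndependent_ev (hσ : IsAut σ) (hD : IsSkewDer σ D) (hne : ∀ c : k, D ≠ c • (σ - 1))
    (hκ : ∀ x, D (σ x) = κ • σ (D x)) (N : ℕ)
    (hN : ∀ m, 0 < m → m < N → ∑ i ∈ Finset.range m, κ ^ i ≠ 0) :
    LinearIndependent k fun ij : Fin (orderOf σ) × Fin N => ev σ D ij.1 ij.2 := by
  induction N with
  | zero => exact linearIndependent_empty_type
  | succ N ih =>
    have hr := hσ.fin.orderOf_pos
    set r := orderOf σ with hrdef
    specialize ih fun m h0 hm => hN m h0 (by omega)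
    have hinj : Function.Injective fun i : Fin r => σ ^ (i : ℕ) := fun i j hij =>
      Fin.ext (pow_injOn_Iio_orderOf i.2 j.2 hij)
    have hα := linearIndependent_counit_pow hσ.mem hσ.one hσ.mul hinj
    rw [Fintype.linearIndependent_iff]
    intro g hg
    rw [Fintype.sum_prod_type] at hg
    simp only [Fin.sum_univ_castSucc, Fin.val_castSucc, Fin.val_last] at hg
    have hlast : ∀ i, g (i, Fin.last N) = 0 := by
      rcases N with _ | M
      · have : ∑ i, g (i, Fin.last 0) •
            (Coalgebra.counit (R := k) ∘ₗ (σ ^ (i : ℕ)) : Dual k H) = 0 := by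
          simpa [ev] using hg
        exact Fintype.linearIndependent_iff.1 hα _ this
      · intro i₀
        obtain ⟨b, hb⟩ := exists_dual_vector ih (i₀, Fin.last M)
        have hb' : ∀ (i : Fin r) (s : ℕ), s < M → ev σ D i s b = 0 := fun i s hs => by
          rw [hb (i, ⟨s, by omega⟩), if_neg]
          intro h
          exact absurd (congrArg (fun x => (x.2 : ℕ)) h) (by simpa using hs.ne)
        have hbM : ∀ i : Fin r, ev σ D i M b = if i = i₀ then 1 else 0 := fun i => by
          have := hb (i, Fin.last M)
          simpa using this
        set S := Submodule.span k (Set.range fun m => ev σ D m 0) with hS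
        have hmS : ∀ m, ev σ D m 0 ∈ S := fun m => Submodule.subset_span ⟨m, rfl⟩
        have hlow : ∀ (i : Fin r) (j : Fin (M + 1)),
            ev σ D i j ∘ₗ LinearMap.mulRight k b ∈ S := by
          intro i j
          rw [ev_comp_mulRight hσ.mul hD hκ]
          refine sum_mem fun s hs => ?_
          rw [Finset.mem_range] at hs
          by_cases hsj : s = j
          · rw [hsj, Nat.sub_self]
            exact Submodule.smul_mem _ _ (hmS _)
          · rw [hb' i s (by omega), mul_zero, zero_smul]
            exact zero_mem _
        have htop : ∀ i : Fin r, ev σ D i (M + 1) ∘ₗ LinearMap.mulRight k b -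
            (if i = i₀ then ∑ l ∈ Finset.range (M + 1), κ ^ l else 0) • ev σ D (i + M) 1 ∈ S := by
          intro i
          rw [ev_comp_mulRight hσ.mul hD hκ, Finset.sum_range_succ, Finset.sum_range_succ,
            Finset.sum_eq_zero fun s hs => by
              rw [hb' i s (Finset.mem_range.1 hs), mul_zero, zero_smul],
            zero_add, hbM, gauss_succ_self, Nat.sub_self, Nat.add_sub_cancel_left]
          rw [mul_ite, mul_one, mul_zero, add_sub_cancel_left]
          exact Submodule.smul_mem _ _ (hmS _)
        have hsum := congrArg (fun φ : Dual k H => φ ∘ₗ LinearMap.mulRight k b) hg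
        simp only [LinearMap.zero_comp] at hsum
        have hK : (g (i₀, Fin.last (M + 1)) * ∑ l ∈ Finset.range (M + 1), κ ^ l) •
            ev σ D (i₀ + M) 1 ∈ S := by
          have h1 : (∑ i, (∑ j : Fin (M + 1), g (i, j.castSucc) •
              (ev σ D i j ∘ₗ LinearMap.mulRight k b) +
              g (i, Fin.last (M + 1)) • (ev σ D i (M + 1) ∘ₗ LinearMap.mulRight k b -
              (if i = i₀ then ∑ l ∈ Finset.range (M + 1), κ ^ l else 0) •
                ev σ D (i + M) 1))) ∈ S :=
            sum_mem fun i _ => add_mem (sum_mem fun j _ => Submodule.smul_mem _ _ (hlow i j))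
              (Submodule.smul_mem _ _ (htop i))
          have h2 : (∑ i, (∑ j : Fin (M + 1), g (i, j.castSucc) •
              (ev σ D i j ∘ₗ LinearMap.mulRight k b) +
              g (i, Fin.last (M + 1)) • (ev σ D i (M + 1) ∘ₗ LinearMap.mulRight k b -
              (if i = i₀ then ∑ l ∈ Finset.range (M + 1), κ ^ l else 0) •
                ev σ D (i + M) 1))) =
              (∑ i : Fin r, (∑ j : Fin (M + 1), g (i, j.castSucc) • ev σ D i j +
                g (i, Fin.last (M + 1)) • ev σ D i (M + 1))) ∘ₗ LinearMap.mulRight k b -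
              (g (i₀, Fin.last (M + 1)) * ∑ l ∈ Finset.range (M + 1), κ ^ l) •
                ev σ D (i₀ + M) 1 := by
            ext a
            simp only [LinearMap.sum_apply, LinearMap.add_apply, LinearMap.smul_apply,
              LinearMap.sub_apply, LinearMap.comp_apply, smul_eq_mul, ite_mul, zero_mul, mul_sub,
              mul_ite, mul_zero, Finset.sum_sub_distrib, Finset.sum_add_distrib,
              Finset.sum_ite_eq', Finset.mem_univ, if_true]
            ring
          rw [h2, hsum, zero_sub] at h1
          exact neg_mem_iff.1 h1
        by_contra hcon
        have hu : g (i₀, Fin.last (M + 1)) * ∑ l ∈ Finset.range (M + 1), κ ^ l ≠ 0 :=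
          mul_ne_zero hcon (hN (M + 1) (Nat.succ_pos _) (Nat.lt_succ_self _))
        exact ev_one_notMem_span hσ hD hne _ ((Submodule.smul_mem_iff _ hu).1 hK)
    simp only [hlast, zero_smul, add_zero] at hg
    have h0 := Fintype.linearIndependent_iff.1 ih (fun ij => g (ij.1, ij.2.castSucc))
      (by rw [Fintype.sum_prod_type]; exact hg)
    rintro ⟨i, j⟩
    induction j using Fin.lastCases with
    | last => exact hlast i
    | cast j => exact h0 (i, j)

end Independence

section LinearAlgebra

variable {k V : Type*} [Field k] [AddCommGroup V] [Module k V]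

lemma exists_ker_of_isNilpotent {D : End k V} (hD : IsNilpotent D) {S : Submodule k V}
    (hS : ∀ x ∈ S, D x ∈ S) (h0 : S ≠ ⊥) : ∃ x ∈ S, x ≠ 0 ∧ D x = 0 := by
  obtain ⟨x, hx, hx0⟩ := Submodule.exists_mem_ne_zero_of_ne_bot h0
  obtain ⟨N, hN⟩ := hD
  have hS' : ∀ m, (D ^ m) x ∈ S := by
    intro m
    induction m with
    | zero => simpa using hx
    | succ m ih => rw [pow_succ', End.mul_apply]; exact hS _ ih
  by_contra! hcon
  have hne : ∀ m, (D ^ m) x ≠ 0 := by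
    intro m
    induction m with
    | zero => simpa using hx0
    | succ m ih => rw [pow_succ', End.mul_apply]; exact hcon _ (hS' m) ih
  exact hne N (by rw [hN]; rfl)

variable [CharZero k]

lemma exists_invariant_projection {T : End k V} {n : ℕ} (hn : 0 < n) (hT : T ^ n = 1)
    {W : Submodule k V} (hW : ∀ x ∈ W, T x ∈ W) :
    ∃ P : End k V, (∀ x, P x ∈ W) ∧ (∀ x ∈ W, P x = x) ∧ ∀ x, P (T x) = T (P x) := by
  have hss : T.IsSemisimple := by
    refine End.isSemisimple_of_squarefree_aeval_eq_zero (p := Polynomial.X ^ n - 1) ?_ ?_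
    · exact (Polynomial.X_pow_sub_one_separable_iff.2 (by exact_mod_cast hn.ne')).squarefree
    · simp [hT]
  obtain ⟨Q, hQ, hc⟩ := End.isSemisimple_iff.1 hss W hW
  refine ⟨W.projection Q hc, Submodule.projection_apply_mem hc,
    fun x hx => Submodule.projection_apply_left hc ⟨x, hx⟩, fun x => ?_⟩
  obtain ⟨a, ha, b, hb, rfl⟩ := Submodule.mem_sup.1
    (hc.sup_eq_top ▸ Submodule.mem_top : x ∈ W ⊔ Q)
  have h1 : ∀ x ∈ W, W.projection Q hc x = x := fun x hx =>
    Submodule.projection_apply_left hc ⟨x, hx⟩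
  have h2 : ∀ x ∈ Q, W.projection Q hc x = 0 := fun x hx =>
    (Submodule.projection_apply_eq_zero_iff hc).2 hx
  rw [map_add, map_add, map_add, h1 _ (hW _ ha), h2 _ (hQ hb), h1 _ ha, h2 _ hb, add_zero,
    add_zero]

end LinearAlgebra

section Eigen

variable {k H : Type*} [Field k] [Ring H] [HopfAlgebra k H]

lemma IsComatrix.eq_zero_of_mulVec {ι : Type*} [Fintype ι] [DecidableEq ι] {b : ι → H}
    {c : Matrix ι ι H} (hc : IsComatrix k b c) {v : ι → H} (hv : c.mulVec v = 0) : v = 0 := by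
  have h := congrArg (Matrix.mulVec (c.map (HopfAlgebra.antipode k))) hv
  rwa [Matrix.mulVec_mulVec, hc.antipode_mul, Matrix.one_mulVec, Matrix.mulVec_zero] at h

/-- The kernel of `D` on the `ν`-eigenspace of `σ`. -/
noncomputable def eker (σ D : End k H) (ν : k) : Submodule k H :=
  LinearMap.ker D ⊓ End.eigenspace σ ν

lemma mem_eker {σ D : End k H} {ν : k} {x : H} :
    x ∈ eker σ D ν ↔ D x = 0 ∧ σ x = ν • x := by
  rw [eker, Submodule.mem_inf, LinearMap.mem_ker, End.mem_eigenspace_iff]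

variable {σ D : End k H} {κ : k}

lemma eker_zero (ν : k) : eker σ 0 ν = End.eigenspace σ ν := by
  rw [eker, LinearMap.ker_zero, top_inf_eq]

variable [CharZero k]

lemma ne_zero_of_hasEigenvalue (hσ : IsAut σ) {μ : k} (hμ : σ.HasEigenvalue μ) : μ ≠ 0 := by
  obtain ⟨x, hx⟩ := hμ.exists_hasEigenvector
  rintro rfl
  have h1 := pow_eq_one_of_eigenvector (pow_orderOf_eq_one σ) hx.apply_eq_smul hx.2
  rw [zero_pow hσ.fin.orderOf_pos.ne'] at h1
  exact zero_ne_one h1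

lemma IsAut.hasEigenvalue_one (hσ : IsAut σ) : σ.HasEigenvalue 1 := by
  have h1 : (1 : H) ≠ 0 := fun h => by
    have := congrArg (Coalgebra.counit (R := k)) h
    rw [Bialgebra.counit_one, map_zero] at this
    exact one_ne_zero this
  exact End.hasEigenvalue_of_hasEigenvector (x := 1)
    ⟨End.mem_eigenspace_iff.2 (by rw [hσ.one, one_smul]), h1⟩

variable [FiniteDimensional k H]

lemma IsSkewDer.card_mul_finrank_eker_le (hσ : IsAut σ) (hD : IsSkewDer σ D)
    (hκ : ∀ x, D (σ x) = κ • σ (D x)) (hnil : IsNilpotent D) {ι : Type*} [Fintype ι]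
    {x : Basis ι k H} {l : ι → k} (hl : ∀ i, σ (x i) = l i • x i) (ν : k) :
    Fintype.card ι * finrank k (eker σ D ν) ≤ ∑ i, finrank k (eker σ D (ν / l i)) := by
  classical
  have hl0 : ∀ i, l i ≠ 0 := fun i h => by
    have h1 := pow_eq_one_of_eigenvector (pow_orderOf_eq_one σ) (hl i) (x.ne_zero i)
    rw [h, zero_pow hσ.fin.orderOf_pos.ne'] at h1
    exact zero_ne_one h1
  obtain ⟨c, hc⟩ := exists_comatrix x.linearIndependent
    (by rw [x.span_eq]; exact fun _ _ _ => trivial)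
  set s := c.map (HopfAlgebra.antipode k) with hs
  have hσc : ∀ i j, σ (c i j) = l j • c i j := by
    intro i j
    rw [hc.apply_eq σ (Matrix.diagonal l) hσ.mem fun j => by
      rw [hl]; simp [Matrix.diagonal_apply, ite_smul]]
    simp [Matrix.diagonal_apply, ite_smul]
  have hDc : ∀ i j, D (c i j) = ∑ m, x.repr (D (x j)) m • c i m :=
    hc.apply_eq D (Matrix.of fun m j => x.repr (D (x j)) m) hD.mem fun j =>
      (x.sum_repr (D (x j))).symm
  obtain ⟨P, hPmem, hPid, hPσ⟩ := exists_invariant_projection (W := LinearMap.ker D)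
    hσ.fin.orderOf_pos (pow_orderOf_eq_one σ) fun y hy => by
      rw [LinearMap.mem_ker] at hy ⊢
      rw [hκ, hy, map_zero, smul_zero]
  have hcw : ∀ b : ι → H, c.mulVec (s.mulVec b) = b := fun b => by
    rw [Matrix.mulVec_mulVec, hc.mul_antipode, Matrix.one_mulVec]
  have hσw : ∀ b : ι → H, (∀ i, b i ∈ eker σ D ν) → ∀ i,
      σ (s.mulVec b i) = (ν / l i) • s.mulVec b i := by
    intro b hb i
    have h0 : c.mulVec (fun j => l j • σ (s.mulVec b j) - ν • s.mulVec b j) = 0 := by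
      ext i
      have h1 := congrFun (hcw b) i
      have h2 := congrArg σ h1
      rw [(mem_eker.1 (hb i)).2, ← h1] at h2
      simp only [Matrix.mulVec, dotProduct, map_sum, hσ.mul, hσc] at h2 ⊢
      simp only [mul_sub, Finset.sum_sub_distrib, mul_smul_comm, Pi.zero_apply]
      simp only [smul_mul_assoc, Finset.smul_sum] at h2
      rw [h2, sub_self]
    have h3 := congrFun (hc.eq_zero_of_mulVec h0) i
    rw [Pi.zero_apply, sub_eq_zero] at h3
    rw [div_eq_inv_mul, mul_smul, ← h3, smul_smul, inv_mul_cancel₀ (hl0 i), one_smul]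
  have hDw : ∀ b : ι → H, (∀ i, b i ∈ eker σ D ν) → ∀ i,
      D (s.mulVec b i) ∈ Submodule.span k (Set.range (s.mulVec b)) := by
    intro b hb i
    have hw := hcw b
    generalize s.mulVec b = w at hw ⊢
    have h0 : c.mulVec (fun j => l j • D (w j) + ∑ m, x.repr (D (x m)) j • w m) = 0 := by
      ext i
      have h2 := congrArg D (congrFun hw i)
      rw [(mem_eker.1 (hb i)).1] at h2
      simp only [Matrix.mulVec, dotProduct, map_sum, hD.leibniz, hσc, hDc] at h2 ⊢
      rw [Finset.sum_add_distrib] at h2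
      simp only [mul_add, Finset.sum_add_distrib, mul_smul_comm, Pi.zero_apply]
      rw [← h2]
      congr 1
      · simp only [smul_mul_assoc]
      · simp only [Finset.mul_sum, Finset.sum_mul]
        rw [Finset.sum_comm]
        simp only [mul_smul_comm, smul_mul_assoc]
    have h3 := congrFun (hc.eq_zero_of_mulVec h0) i
    rw [Pi.zero_apply] at h3
    rw [← Submodule.smul_mem_iff _ (hl0 i), eq_neg_of_add_eq_zero_left h3]
    exact neg_mem (sum_mem fun m _ => Submodule.smul_mem _ _ (Submodule.subset_span ⟨m, rfl⟩))
  let Φ : (ι → eker σ D ν) →ₗ[k] ((i : ι) → eker σ D (ν / l i)) :=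
    { toFun := fun b i => ⟨P (s.mulVec (fun j => (b j : H)) i), mem_eker.2
        ⟨hPmem _, by rw [← hPσ, hσw _ fun j => (b j).2, map_smul]⟩⟩
      map_add' := fun b b' => by
        ext i
        simp only [Pi.add_apply, Submodule.coe_add, ← map_add]
        congr 1
        simp only [Matrix.mulVec, dotProduct, mul_add, Finset.sum_add_distrib]
      map_smul' := fun a b => by
        ext i
        simp only [Pi.smul_apply, Submodule.coe_smul, RingHom.id_apply, ← map_smul]
        congr 1
        simp only [Matrix.mulVec, dotProduct, mul_smul_comm, Finset.smul_sum] }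
  have hΦ : Function.Injective Φ := by
    rw [← LinearMap.ker_eq_bot, LinearMap.ker_eq_bot']
    intro b hb
    set w := s.mulVec fun j => (b j : H) with hw
    have hPw : ∀ i, P (w i) = 0 := fun i => congrArg Subtype.val (congrFun hb i)
    have hS : Submodule.span k (Set.range w) = ⊥ := by
      by_contra hne
      have hstab : ∀ y ∈ Submodule.span k (Set.range w), D y ∈ Submodule.span k (Set.range w) := by
        intro y hy
        have : Submodule.span k (Set.range w) ≤ (Submodule.span k (Set.range w)).comap D := by
          rw [Submodule.span_le]
          rintro _ ⟨i, rfl⟩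
          exact hDw _ (fun j => (b j).2) i
        exact this hy
      obtain ⟨y, hy, hy0, hDy⟩ := exists_ker_of_isNilpotent hnil hstab hne
      have hPy : Submodule.span k (Set.range w) ≤ LinearMap.ker P := by
        rw [Submodule.span_le]
        rintro _ ⟨i, rfl⟩
        exact hPw i
      exact hy0 ((hPid y hDy).symm.trans (hPy hy))
    have hw0 : w = 0 := by
      ext i
      have : w i ∈ Submodule.span k (Set.range w) := Submodule.subset_span ⟨i, rfl⟩
      rwa [hS, Submodule.mem_bot] at this
    have h1 := hcw fun j => (b j : H)
    rw [← hw, hw0, Matrix.mulVec_zero] at h1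
    ext i
    exact (congrFun h1 i).symm
  have hle := LinearMap.finrank_le_finrank_of_injective hΦ
  rwa [finrank_pi_fintype, finrank_pi_fintype, Finset.sum_const, smul_eq_mul,
    Finset.card_univ] at hle

variable [IsAlgClosed k]

lemma exists_eigenbasis (hσ : IsAut σ) :
    ∃ x : Basis (Σ μ : σ.Eigenvalues, Fin (finrank k (End.eigenspace σ μ.val))) k H,
      ∀ i, σ (x i) = (i.1.val : k) • x i := by
  classical
  have hint : DirectSum.IsInternal fun μ : σ.Eigenvalues => End.eigenspace σ μ.val := by
    rw [DirectSum.isInternal_submodule_iff_iSupIndep_and_iSup_eq_top]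
    refine ⟨(End.eigenspaces_iSupIndep σ).comp Subtype.val_injective, ?_⟩
    rw [← iSup_eigenspace_of_pow_eq_one hσ.fin.orderOf_pos (pow_orderOf_eq_one σ)]
    refine le_antisymm (iSup_le fun μ => le_iSup (fun μ : k => End.eigenspace σ μ) μ.val)
      (iSup_le fun μ => ?_)
    by_cases hμ : σ.HasEigenvalue μ
    · exact le_iSup (fun μ : σ.Eigenvalues => End.eigenspace σ μ.val) ⟨μ, hμ⟩
    · rw [End.hasEigenvalue_iff, not_not] at hμ
      rw [hμ]
      exact bot_le
  refine ⟨hint.collectedBasis fun μ => finBasis k _, fun i => ?_⟩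
  exact End.mem_eigenspace_iff.1 (hint.collectedBasis_mem _ i)

lemma finrank_eq_sum_eigenspace (hσ : IsAut σ) :
    finrank k H = ∑ μ : σ.Eigenvalues, finrank k (End.eigenspace σ μ.val) := by
  obtain ⟨x, -⟩ := exists_eigenbasis hσ
  rw [finrank_eq_card_basis x, Fintype.card_sigma]
  simp

lemma IsSkewDer.finrank_mul_eker_le (hσ : IsAut σ) (hD : IsSkewDer σ D)
    (hκ : ∀ x, D (σ x) = κ • σ (D x)) (hnil : IsNilpotent D) (ν : k) :
    finrank k H * finrank k (eker σ D ν) ≤ ∑ μ : σ.Eigenvalues,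
      finrank k (End.eigenspace σ μ.val) * finrank k (eker σ D (ν / μ.val)) := by
  obtain ⟨x, hx⟩ := exists_eigenbasis hσ
  have h := hD.card_mul_finrank_eker_le hσ hκ hnil hx ν
  rw [← finrank_eq_card_basis x, Fintype.sum_sigma] at h
  have hsum : ∀ μ : σ.Eigenvalues, ∑ _y : Fin (finrank k (End.eigenspace σ μ.val)),
      finrank k (eker σ D (ν / μ.val)) =
        finrank k (End.eigenspace σ μ.val) * finrank k (eker σ D (ν / μ.val)) := fun μ => by
    rw [Finset.sum_const, Finset.card_univ, Fintype.card_fin, smul_eq_mul]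
  exact h.trans (le_of_eq (Finset.sum_congr rfl fun μ _ => hsum μ))

/-- All eigenspaces of `σ` have the same dimension. -/
lemma exists_eigenspace_finrank (hσ : IsAut σ) :
    ∃ h : ℕ, 0 < h ∧ (∀ μ, σ.HasEigenvalue μ → finrank k (End.eigenspace σ μ) = h) ∧
      ∀ μ ν, σ.HasEigenvalue μ → σ.HasEigenvalue ν → σ.HasEigenvalue (μ / ν) := by
  have hpos : ∀ μ, σ.HasEigenvalue μ ↔ 0 < finrank k (End.eigenspace σ μ) := fun μ => by
    rw [End.hasEigenvalue_iff, Nat.pos_iff_ne_zero, Ne, Ne, Submodule.finrank_eq_zero]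
  have : Nonempty σ.Eigenvalues := ⟨⟨1, hσ.hasEigenvalue_one⟩⟩
  obtain ⟨μ₀, hμ₀⟩ := Finite.exists_max
    fun μ : σ.Eigenvalues => finrank k (End.eigenspace σ μ.val)
  set h := finrank k (End.eigenspace σ μ₀.val) with hh
  have hh0 : 0 < h := (hpos _).1 μ₀.2
  have hle : ∀ ν, finrank k (End.eigenspace σ ν) ≤ h := fun ν => by
    by_cases hν : σ.HasEigenvalue ν
    · exact hμ₀ ⟨ν, hν⟩
    · rw [hpos, not_lt, Nat.le_zero] at hν
      omega
  have hzero : IsSkewDer σ (0 : End k H) := ⟨zero_mem _, fun a b => by simp⟩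
  have hstep : ∀ ν, finrank k (End.eigenspace σ ν) = h → ∀ μ, σ.HasEigenvalue μ →
      finrank k (End.eigenspace σ (ν / μ)) = h := by
    intro ν hν μ hμ
    have h1 := hzero.finrank_mul_eker_le (κ := 1) hσ (fun x => by simp) IsNilpotent.zero ν
    rw [eker_zero, Finset.sum_congr rfl fun μ _ => by rw [eker_zero]] at h1
    rw [hν, finrank_eq_sum_eigenspace hσ, Finset.sum_mul] at h1
    by_contra hne
    refine absurd h1 (not_le.2 (Finset.sum_lt_sum
      (fun μ _ => Nat.mul_le_mul_left _ (hle _)) ⟨⟨μ, hμ⟩, Finset.mem_univ _, ?_⟩))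
    exact Nat.mul_lt_mul_of_pos_left (lt_of_le_of_ne (hle _) hne) ((hpos μ).1 hμ)
  have h1 : finrank k (End.eigenspace σ (1 : k)) = h := by
    have := hstep _ rfl μ₀.val μ₀.2
    have h2 : (μ₀.val / μ₀.val : k) = 1 := div_self (ne_zero_of_hasEigenvalue hσ μ₀.2)
    rwa [h2] at this
  have hinv : ∀ μ, σ.HasEigenvalue μ → σ.HasEigenvalue μ⁻¹ := fun μ hμ => by
    rw [hpos, ← one_div, hstep _ h1 μ hμ]
    exact hh0
  have hall : ∀ μ, σ.HasEigenvalue μ → finrank k (End.eigenspace σ μ) = h := fun μ hμ => by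
    have := hstep _ h1 _ (hinv μ hμ)
    rwa [one_div, inv_inv] at this
  exact ⟨h, hh0, hall, fun μ ν hμ hν => (hpos _).2 ((hstep _ (hall μ hμ) ν hν).symm ▸ hh0)⟩

lemma card_eigenvalues (hσ : IsAut σ) : Fintype.card σ.Eigenvalues = orderOf σ := by
  obtain ⟨h, -, -, hdiv⟩ := exists_eigenspace_finrank hσ
  have hinv : ∀ μ, σ.HasEigenvalue μ → σ.HasEigenvalue μ⁻¹ := fun μ hμ => by
    simpa using hdiv 1 μ hσ.hasEigenvalue_one hμ
  let G : Subgroup kˣ :=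
    { carrier := {u | σ.HasEigenvalue (u : k)}
      mul_mem' := fun {u v} hu hv => by
        have := hdiv _ _ hu (hinv _ hv)
        rwa [div_inv_eq_mul] at this
      one_mem' := hσ.hasEigenvalue_one
      inv_mem' := fun {u} hu => by
        have := hinv _ hu
        simpa using this }
  let e : σ.Eigenvalues ≃ G :=
    { toFun := fun μ => ⟨Units.mk0 μ.val (ne_zero_of_hasEigenvalue hσ μ.2), μ.2⟩
      invFun := fun u => ⟨u.1, u.2⟩
      left_inv := fun μ => rfl
      right_inv := fun u => Subtype.ext (Units.ext rfl) }
  have : Finite G := Finite.of_equiv _ e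
  have hcard : Fintype.card σ.Eigenvalues = Nat.card G := by
    rw [← Nat.card_eq_fintype_card, Nat.card_congr e]
  have hr := hσ.fin.orderOf_pos
  rw [hcard]
  refine le_antisymm ?_ (orderOf_le_of_pow_eq_one Nat.card_pos ?_)
  · have hle : G ≤ rootsOfUnity (orderOf σ) k := by
      intro u hu
      obtain ⟨x, hx⟩ := (show σ.HasEigenvalue (u : k) from hu).exists_hasEigenvector
      have h1 := pow_eq_one_of_eigenvector (pow_orderOf_eq_one σ) hx.apply_eq_smul hx.2
      exact Units.ext (by simpa using h1)
    have : NeZero (orderOf σ) := ⟨hr.ne'⟩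
    refine (Nat.card_le_card_of_injective _ (Subgroup.inclusion_injective hle)).trans ?_
    exact card_rootsOfUnity k (orderOf σ)
  · obtain ⟨x, hx⟩ := exists_eigenbasis hσ
    refine x.ext fun i => ?_
    have h1 : (e i.1) ^ Nat.card G = 1 := pow_card_eq_one'
    have h2 : (i.1.val : k) ^ Nat.card G = 1 := by
      have := congrArg (fun u : G => ((u : kˣ) : k)) h1
      rwa [Subgroup.coe_pow, Units.val_pow_eq_pow_val] at this
    have h3 : ∀ m : ℕ, (σ ^ m) (x i) = (i.1.val : k) ^ m • x i := by
      intro m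
      induction m with
      | zero => simp
      | succ m ih => rw [pow_succ', End.mul_apply, ih, map_smul, hx, smul_smul, pow_succ]
    rw [h3, h2, one_smul, End.one_apply]

lemma orderOf_dvd_finrank (hσ : IsAut σ) : orderOf σ ∣ finrank k H := by
  obtain ⟨h, -, hall, -⟩ := exists_eigenspace_finrank hσ
  refine ⟨h, ?_⟩
  rw [finrank_eq_sum_eigenspace hσ, Finset.sum_congr rfl fun μ _ => hall μ.val μ.2,
    Finset.sum_const, Finset.card_univ, card_eigenvalues hσ, smul_eq_mul]

lemma IsSkewDer.orderOf_mul_finrank_eker_le (hσ : IsAut σ) (hD : IsSkewDer σ D)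
    (hκ : ∀ x, D (σ x) = κ • σ (D x)) (hnil : IsNilpotent D) {ν : k} (hν : ν ≠ 0) :
    orderOf σ * finrank k (eker σ D ν) ≤ finrank k (LinearMap.ker D) := by
  classical
  obtain ⟨h, hh0, hall, -⟩ := exists_eigenspace_finrank hσ
  have h1 := hD.finrank_mul_eker_le hσ hκ hnil ν
  have hn : finrank k H = orderOf σ * h := by
    rw [finrank_eq_sum_eigenspace hσ, Finset.sum_congr rfl fun μ _ => hall μ.val μ.2,
      Finset.sum_const, Finset.card_univ, card_eigenvalues hσ, smul_eq_mul]
  rw [Finset.sum_congr rfl fun μ _ => by rw [hall μ.val μ.2], ← Finset.mul_sum, hn] at h1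
  have h2 : orderOf σ * finrank k (eker σ D ν) ≤
      ∑ μ : σ.Eigenvalues, finrank k (eker σ D (ν / μ.val)) := by
    refine Nat.le_of_mul_le_mul_left ?_ hh0
    calc h * (orderOf σ * finrank k (eker σ D ν))
        = orderOf σ * h * finrank k (eker σ D ν) := by ring
      _ ≤ _ := h1
  refine h2.trans ?_
  have hind : iSupIndep fun μ : σ.Eigenvalues => eker σ D (ν / μ.val) := by
    have hinj : Function.Injective fun μ : σ.Eigenvalues => ν / μ.val := by
      intro μ μ' hμ
      refine Subtype.ext ?_
      exact inv_injective (mul_left_cancel₀ hν (by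
        simp only [div_eq_mul_inv] at hμ
        exact hμ))
    exact ((End.eigenspaces_iSupIndep σ).comp hinj).mono fun μ => inf_le_right
  let Ψ : ((μ : σ.Eigenvalues) → eker σ D (ν / μ.val)) →ₗ[k] LinearMap.ker D :=
    LinearMap.lsum k (fun μ : σ.Eigenvalues => eker σ D (ν / μ.val)) ℕ
      fun μ => Submodule.inclusion inf_le_left
  have hΨ : Function.Injective Ψ := by
    rw [← LinearMap.ker_eq_bot, LinearMap.ker_eq_bot']
    intro b hb
    have hs : ∑ μ, (b μ : H) = 0 := by
      have := congrArg Subtype.val hb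
      simp only [Ψ, LinearMap.lsum_apply, LinearMap.sum_apply, LinearMap.comp_apply,
        LinearMap.proj_apply, AddSubmonoidClass.coe_finsetSum] at this
      exact this
    ext μ
    have h3 : (b μ : H) = -∑ μ' ∈ Finset.univ.erase μ, (b μ' : H) := by
      rw [← Finset.add_sum_erase _ _ (Finset.mem_univ μ)] at hs
      exact eq_neg_of_add_eq_zero_left hs
    have h4 := Submodule.disjoint_def.1 (hind μ) (b μ) (b μ).2 (by
      rw [h3]
      refine neg_mem (sum_mem fun μ' hμ' => ?_)
      exact Submodule.mem_iSup_of_mem μ' (Submodule.mem_iSup_of_mem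
        (Finset.ne_of_mem_erase hμ') (b μ').2))
    exact h4
  have hle := LinearMap.finrank_le_finrank_of_injective hΨ
  rwa [finrank_pi_fintype] at hle

end Eigen

lemma eq_prime_of_mul_le {p r N : ℕ} (hp : p.Prime) (hr : r ∣ p ^ 3) (hN : N ∣ r) (hN1 : N ≠ 1)
    (hle : r * N ≤ p ^ 3) : N = p ∧ (r = p ∨ r = p ^ 2) := by
  obtain ⟨a, -, rfl⟩ := (Nat.dvd_prime_pow hp).1 hr
  obtain ⟨b, hb, rfl⟩ := (Nat.dvd_prime_pow hp).1 hN
  rw [← pow_add, Nat.pow_le_pow_iff_right hp.one_lt] at hle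
  have hb0 : b ≠ 0 := fun h => hN1 (by rw [h, pow_zero])
  obtain rfl : b = 1 := by omega
  obtain rfl | rfl : a = 1 ∨ a = 2 := by omega
  · simp
  · simp

section Numerics

variable {k H : Type*} [Field k] [Ring H] [HopfAlgebra k H] {σ D : End k H} {κ : k}

lemma exists_skew_comm (hσ : IsAut σ) (hne : ∀ c : k, D ≠ c • (σ - 1)) {q : k}
    (hq : ∀ x, σ (D x) = q • D (σ x)) : ∀ x, D (σ x) = q⁻¹ • σ (D x) := by
  have hq0 : q ≠ 0 := by
    rintro rfl
    have hσ0 : ∀ x, σ x = 0 → x = 0 := fun x hx => by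
      have h1 : (σ ^ orderOf σ) x = x := by rw [pow_orderOf_eq_one, End.one_apply]
      rw [← h1, ← Nat.sub_add_cancel hσ.fin.orderOf_pos, pow_succ, End.mul_apply, hx, map_zero]
    refine hne 0 (LinearMap.ext fun x => ?_)
    rw [zero_smul, LinearMap.zero_apply]
    exact hσ0 _ (by rw [hq, zero_smul])
  intro x
  rw [hq, smul_smul, inv_mul_cancel₀ hq0, one_smul]

lemma skew_comm_pow_orderOf (hne : ∀ c : k, D ≠ c • (σ - 1))
    (hκ : ∀ x, D (σ x) = κ • σ (D x)) : κ ^ orderOf σ = 1 := by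
  obtain ⟨x, hx⟩ : ∃ x, D x ≠ 0 := by
    by_contra! h
    exact hne 0 (LinearMap.ext fun x => by rw [h, zero_smul, LinearMap.zero_apply])
  have h := apply_pow_of_skew_comm hκ (orderOf σ) x
  rw [pow_orderOf_eq_one, End.one_apply, End.one_apply] at h
  have h2 : (κ ^ orderOf σ - 1) • D x = 0 := by rw [sub_smul, ← h, one_smul, sub_self]
  exact sub_eq_zero.1 ((smul_eq_zero.1 h2).resolve_right hx)

lemma exists_apply_grouplike {T : End k H} (hT : T ∈ actAlgebra k H) {g : H}
    (hg : g ∈ grouplikes k H) : ∃ c : k, T g = c • g := by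
  have hl := (isSimpleRC_line hg).1.apply_mem hT (Submodule.mem_span_singleton_self g)
  obtain ⟨c, hc⟩ := Submodule.mem_span_singleton.1 hl
  exact ⟨c, hc.symm⟩

lemma isAut_one : IsAut (1 : End k H) :=
  ⟨one_mem _, rfl, fun _ _ => rfl, IsOfFinOrder.one⟩

lemma skewDer_grouplike [CharZero k] (hσ : IsAut σ) (hD : IsSkewDer σ D) (hκ1 : κ ≠ 1)
    (hκ : ∀ x, D (σ x) = κ • σ (D x)) {g : H} (hg : g ∈ grouplikes k H) : D g = 0 := by
  obtain ⟨c, hc⟩ := exists_apply_grouplike hD.mem hg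
  obtain ⟨d, hd⟩ := exists_apply_grouplike hσ.mem hg
  have hd0 : d ≠ 0 := fun h => by
    have h1 := pow_eq_one_of_eigenvector (pow_orderOf_eq_one σ) hd hg.1
    rw [h, zero_pow hσ.fin.orderOf_pos.ne'] at h1
    exact zero_ne_one h1
  have h := hκ g
  rw [hd, map_smul, hc, map_smul, hd, smul_smul, smul_smul, smul_smul, ← sub_eq_zero,
    ← sub_smul] at h
  have h1 := (smul_eq_zero.1 h).resolve_right hg.1
  have h2 : d * c * (1 - κ) = 0 := by linear_combination h1
  have hc0 : c = 0 := by
    rcases mul_eq_zero.1 h2 with h3 | h3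
    · exact (mul_eq_zero.1 h3).resolve_left hd0
    · exact absurd (sub_eq_zero.1 h3).symm hκ1
  rw [hc, hc0, zero_smul]

variable [FiniteDimensional k H]

lemma orderOf_mul_le_finrank (hσ : IsAut σ) (hD : IsSkewDer σ D) (hne : ∀ c : k, D ≠ c • (σ - 1))
    (hκ : ∀ x, D (σ x) = κ • σ (D x)) {N : ℕ}
    (hN : ∀ m, 0 < m → m < N → ∑ i ∈ Finset.range m, κ ^ i ≠ 0) :
    orderOf σ * N ≤ finrank k H := by
  have h := (linearIndependent_ev hσ hD hne hκ N hN).fintype_card_le_finrank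
  rwa [Fintype.card_prod, Fintype.card_fin, Fintype.card_fin, Subspace.dual_finrank_eq] at h

lemma skew_comm_ne_one [CharZero k] (hσ : IsAut σ) (hD : IsSkewDer σ D)
    (hne : ∀ c : k, D ≠ c • (σ - 1)) (hκ : ∀ x, D (σ x) = κ • σ (D x)) : κ ≠ 1 := by
  rintro rfl
  have h := orderOf_mul_le_finrank hσ hD hne hκ (N := finrank k H + 1) fun m h0 _ => by
    simpa using h0.ne'
  have := Nat.le_mul_of_pos_left (finrank k H + 1) hσ.fin.orderOf_pos
  omega

lemma IsSkewDer.eq_zero [CharZero k] (hD : IsSkewDer (1 : End k H) D) : D = 0 := by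
  by_contra hne
  refine skew_comm_ne_one (κ := 1) isAut_one hD (fun c hc => hne ?_) (fun x => ?_) rfl
  · rw [hc, sub_self, smul_zero]
  · rw [one_smul]; rfl

lemma geom_sum_ne_zero_of_lt {m : ℕ} (h0 : 0 < m) (hm : m < orderOf κ) :
    ∑ i ∈ Finset.range m, κ ^ i ≠ 0 := by
  intro h
  have h1 := mul_geom_sum κ m
  rw [h, mul_zero, eq_comm, sub_eq_zero] at h1
  exact absurd (orderOf_le_of_pow_eq_one h0 h1) (not_le.2 hm)

lemma IsSkewDer.pow_eq_zero [CharZero k] (hD : IsSkewDer σ D)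
    (hκ : ∀ x, D (σ x) = κ • σ (D x)) {p : ℕ} (hp : p ≠ 0) (hprim : IsPrimitiveRoot κ p)
    (hσp : σ ^ p = 1) : D ^ p = 0 := by
  refine IsSkewDer.eq_zero ⟨pow_mem hD.mem _, fun a b => ?_⟩
  obtain ⟨n, rfl⟩ := Nat.exists_eq_succ_of_ne_zero hp
  rw [hD.pow_apply_mul hκ, Finset.sum_range_succ, Finset.sum_range_succ', gauss_self,
    gauss_zero_right, Finset.sum_eq_zero fun s hs => by
      rw [gauss_eq_zero_of_isPrimitiveRoot hprim (Nat.succ_pos s)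
        (by have := Finset.mem_range.1 hs; omega), zero_smul], hσp]
  simp [add_comm]

end Numerics

section Copointed

variable {k H : Type*} [Field k] [Ring H] [HopfAlgebra k H] [FiniteDimensional k H]
  {σ D : End k H} {κ : k}

lemma apply_mul_eq_zero_of_isSubcoalg {C : Submodule k (Dual k H)}
    (hC : IsSubcoalgWrt k (dualComul k H) C) {a b : H}
    (h : a ∈ C.dualCoannihilator ∨ b ∈ C.dualCoannihilator) : a * b ∈ C.dualCoannihilator := by
  rw [Submodule.mem_dualCoannihilator]
  intro f hf
  obtain ⟨t, ht⟩ := hC f hf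
  rw [← dualDistrib_dualComul, ← ht]
  clear ht
  induction t with
  | zero => simp
  | add x y hx hy => rw [map_add, map_add, LinearMap.add_apply, hx, hy, add_zero]
  | tmul x y =>
    rw [TensorProduct.map_tmul, TensorProduct.dualDistrib_apply, Submodule.subtype_apply,
      Submodule.subtype_apply]
    rcases h with h | h
    · rw [(Submodule.mem_dualCoannihilator _).1 h _ x.2, zero_mul]
    · rw [(Submodule.mem_dualCoannihilator _).1 h _ y.2, mul_zero]

lemma dualComul_eq_tmul {f : Dual k H} (hf : ∀ a b, f (a * b) = f a * f b) :
    dualComul k H f = f ⊗ₜ f := by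
  refine (TensorProduct.dualDistribEquiv k H H).injective (TensorProduct.ext' fun a b => ?_)
  refine (dualDistrib_dualComul f a b).trans ?_
  rw [hf]
  exact (TensorProduct.dualDistrib_apply f f a b).symm

/-- If the functionals `ε ∘ σ ^ i ∘ D ^ j` span the dual, then the dual is pointed. -/
lemma isCopointed_of_orderOf_mul_eq (hσ : IsAut σ) (hD : IsSkewDer σ D)
    (hne : ∀ c : k, D ≠ c • (σ - 1)) (hκ : ∀ x, D (σ x) = κ • σ (D x)) {N : ℕ}
    (hN : ∀ m, 0 < m → m < N → ∑ i ∈ Finset.range m, κ ^ i ≠ 0)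
    (hcard : orderOf σ * N = finrank k H) : IsCopointed k H := by
  rintro C ⟨hC, hC0, hCs⟩
  have hr := hσ.fin.orderOf_pos
  set I := C.dualCoannihilator with hI
  have hev1 : ∀ i, ev σ D i 0 1 = 1 := fun i => by
    simp [ev, pow_one_apply hσ.one]
  have hevm : ∀ i a b, ev σ D i 0 (a * b) = ev σ D i 0 a * ev σ D i 0 b := fun i a b => by
    simp [ev_apply_mul hσ.mul hD hκ]
  by_cases hex : ∃ i, ∀ x ∈ I, ev σ D i 0 x = 0
  · obtain ⟨i, hi⟩ := hex
    have hmem : ev σ D i 0 ∈ C := by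
      rw [← Subspace.dualCoannihilator_dualAnnihilator_eq (W := C)]
      exact (Submodule.mem_dualAnnihilator _).2 hi
    have hne0 : ev σ D i 0 ≠ 0 := fun h => by
      have := hev1 i
      rw [h, LinearMap.zero_apply] at this
      exact zero_ne_one this
    have hle : Submodule.span k {ev σ D i 0} ≤ C := by
      rwa [Submodule.span_singleton_le_iff_mem]
    have hsub : IsSubcoalgWrt k (dualComul k H) (Submodule.span k {ev σ D i 0}) := by
      intro x hx
      obtain ⟨c, rfl⟩ := Submodule.mem_span_singleton.1 hx
      rw [map_smul, dualComul_eq_tmul (hevm i)]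
      exact Submodule.smul_mem _ _ ⟨(⟨_, Submodule.mem_span_singleton_self _⟩ : Submodule.span k _)
        ⊗ₜ ⟨_, Submodule.mem_span_singleton_self _⟩, rfl⟩
    rcases hle.lt_or_eq with hlt | heq
    · have := hCs _ hsub hlt
      rw [Submodule.span_singleton_eq_bot] at this
      exact absurd this hne0
    · rw [← heq, finrank_span_singleton hne0]
  · exfalso
    push Not at hex
    have hx : ∀ n : ℕ, ∃ x ∈ I, ∀ i < n, ev σ D i 0 x = 1 := by
      intro n
      induction n with
      | zero => exact ⟨0, zero_mem _, fun i hi => absurd hi (Nat.not_lt_zero i)⟩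
      | succ n ih =>
        obtain ⟨x, hxI, hx⟩ := ih
        obtain ⟨y, hyI, hy⟩ := hex n
        set y' := (ev σ D n 0 y)⁻¹ • y with hy'
        have hyI' : y' ∈ I := Submodule.smul_mem _ _ hyI
        have hyn : ev σ D n 0 y' = 1 := by
          rw [hy', map_smul, smul_eq_mul, inv_mul_cancel₀ hy]
        refine ⟨x + y' - x * y', sub_mem (add_mem hxI hyI')
          (apply_mul_eq_zero_of_isSubcoalg hC (Or.inl hxI)), fun i hi => ?_⟩
        rw [map_sub, map_add, hevm]
        rcases Nat.lt_succ_iff_lt_or_eq.1 hi with h | rfl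
        · rw [hx i h]; ring
        · rw [hyn]; ring
    obtain ⟨x, hxI, hx⟩ := hx (orderOf σ)
    have hx' : ∀ i, ev σ D i 0 x = 1 := fun i => by
      rw [← hx (i % orderOf σ) (Nat.mod_lt _ hr), ev, ev, pow_mod_orderOf]
    have hw : ∀ m i j, j < m → ev σ D i j ((1 - x) ^ m) = 0 := by
      intro m
      induction m with
      | zero => exact fun i j hj => absurd hj (Nat.not_lt_zero j)
      | succ m ih =>
        intro i j hj
        rw [pow_succ', ev_apply_mul hσ.mul hD hκ]
        refine Finset.sum_eq_zero fun s hs => ?_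
        rw [Finset.mem_range] at hs
        rcases lt_or_ge s m with h | h
        · rw [ih i s h, mul_zero, mul_zero]
        · have : j - s = 0 := by omega
          rw [this, map_sub, hev1, hx', sub_self, zero_mul, mul_zero]
    have hli := linearIndependent_ev hσ hD hne hκ N hN
    have hspan := hli.span_eq_top_of_card_eq_finrank' (by
      rw [Fintype.card_prod, Fintype.card_fin, Fintype.card_fin, Subspace.dual_finrank_eq, hcard])
    have hw0 : (1 - x) ^ N = 0 := by
      refine eq_of_dual fun f : Dual k H => ?_
      have hf : f ∈ Submodule.span k (Set.range fun ij : Fin (orderOf σ) × Fin N =>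
        ev σ D ij.1 ij.2) := hspan ▸ Submodule.mem_top
      rw [map_zero]
      induction hf using Submodule.span_induction with
      | mem f hf => obtain ⟨ij, rfl⟩ := hf; exact hw _ _ _ ij.2.2
      | zero => rfl
      | add f g _ _ hf hg => rw [LinearMap.add_apply, hf, hg, add_zero]
      | smul c f _ hf => rw [LinearMap.smul_apply, hf, smul_zero]
    have h1 : ∀ m : ℕ, 1 - (1 - x) ^ m ∈ I := by
      intro m
      induction m with
      | zero => simp
      | succ m ih =>
        have : 1 - (1 - x) ^ (m + 1) = (1 - (1 - x) ^ m) + (1 - x) ^ m * x := by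
          rw [pow_succ, mul_sub, mul_one]; abel
        rw [this]
        exact add_mem ih (apply_mul_eq_zero_of_isSubcoalg hC (Or.inr hxI))
    have h1I : (1 : H) ∈ I := by simpa [hw0] using h1 N
    refine hC0 ((Submodule.eq_bot_iff _).2 fun f hf => LinearMap.ext fun y => ?_)
    have := apply_mul_eq_zero_of_isSubcoalg hC (a := 1) (b := y) (Or.inl h1I)
    rw [one_mul] at this
    exact (Submodule.mem_dualCoannihilator _).1 this f hf

end Copointed

/-- A nontrivial skew-primitive of the dual of a non-copointed Hopf algebra of dimension `p ^ 3`
gives rise to a nilpotent skew derivation. -/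
lemma exists_nilpotent_skewDer {k H : Type*} [Field k] [IsAlgClosed k] [CharZero k] [Ring H]
    [HopfAlgebra k H] [FiniteDimensional k H] {p : ℕ} (hp : p.Prime) (hdim : finrank k H = p ^ 3)
    (hncop : ¬ IsCopointed k H) (hH : ¬ HasNoNontrivialSkewPrimitivesWrt k (dualComul k H)) :
    ∃ (σ D : End k H) (κ : k), IsAut σ ∧ IsSkewDer σ D ∧ (∀ c : k, D ≠ c • (σ - 1)) ∧
      (∀ x, D (σ x) = κ • σ (D x)) ∧ IsPrimitiveRoot κ p ∧ orderOf σ = p ∧ D ^ p = 0 := by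
  obtain ⟨σ, D₀, hσ, hD₀, hne₀⟩ := exists_skewDer hH
  obtain ⟨D, q, hD, hne, hq⟩ := exists_eigen_skewDer hσ hD₀ hne₀
  have hκ := exists_skew_comm hσ hne hq
  set κ := q⁻¹
  have hκ1 := skew_comm_ne_one hσ hD hne hκ
  have hgeom : ∀ m, 0 < m → m < orderOf κ → ∑ i ∈ Finset.range m, κ ^ i ≠ 0 :=
    fun m h0 hm => geom_sum_ne_zero_of_lt h0 hm
  have hle := orderOf_mul_le_finrank hσ hD hne hκ hgeom
  have hdvd := orderOf_dvd_finrank hσ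
  rw [hdim] at hle hdvd
  obtain ⟨hN, hr⟩ := eq_prime_of_mul_le hp hdvd
    (orderOf_dvd_of_pow_eq_one (skew_comm_pow_orderOf hne hκ))
    (fun h => hκ1 (orderOf_eq_one_iff.1 h)) hle
  have hprim : IsPrimitiveRoot κ p := hN ▸ IsPrimitiveRoot.orderOf κ
  rcases hr with hr | hr
  · exact ⟨σ, D, κ, hσ, hD, hne, hκ, hprim, hr,
      hD.pow_eq_zero hκ hp.ne_zero hprim (hr ▸ pow_orderOf_eq_one σ)⟩
  · exact absurd (isCopointed_of_orderOf_mul_eq hσ hD hne hκ hgeom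
      (by rw [hr, hN, hdim]; ring)) hncop

section MatrixMap

variable {k H A : Type*} [Field k] [Ring H] [Algebra k H] [Ring A] [Algebra k A]
  {n : Type*}

/-- A scalar matrix viewed as a matrix with entries in an algebra. -/
abbrev scalarMat (A : Type*) [Ring A] [Algebra k A] (F : Matrix n n k) : Matrix n n A :=
  F.map (algebraMap k A)

lemma scalarMat_self (F : Matrix n n k) : scalarMat k F = F := by
  ext i j; simp

variable [Fintype n]

lemma map_scalarMat_mul (T : H →ₗ[k] A) (F : Matrix n n k) (X : Matrix n n H) :
    (scalarMat H F * X).map T = scalarMat A F * X.map T := by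
  ext i j
  simp [Matrix.mul_apply, ← Algebra.smul_def]

lemma map_mul_scalarMat (T : H →ₗ[k] A) (F : Matrix n n k) (X : Matrix n n H) :
    (X * scalarMat H F).map T = X.map T * scalarMat A F := by
  ext i j
  simp [Matrix.mul_apply, ← Algebra.commutes, ← Algebra.smul_def]

lemma mul_scalarMat_apply (F : Matrix n n k) (X : Matrix n n H) (i j : n) :
    (X * scalarMat H F) i j = ∑ l, F l j • X i l := by
  simp [Matrix.mul_apply, ← Algebra.commutes, ← Algebra.smul_def]

lemma scalarMat_mul (F G : Matrix n n k) : scalarMat A (F * G) = scalarMat A F * scalarMat A G :=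
  Matrix.map_mul

end MatrixMap

section Comatrix

variable {k H : Type*} [Field k] [Ring H] [HopfAlgebra k H] {σ D : End k H} {κ : k}
  {n : Type*} [Fintype n]

lemma IsAut.map_mul (hσ : IsAut σ) (X Y : Matrix n n H) :
    (X * Y).map σ = X.map σ * Y.map σ := by
  ext i j
  simp [Matrix.mul_apply, hσ.mul]

lemma IsSkewDer.map_mul (hD : IsSkewDer σ D) (X Y : Matrix n n H) :
    (X * Y).map D = X.map σ * Y.map D + X.map D * Y := by
  ext i j
  simp [Matrix.mul_apply, hD.leibniz, Finset.sum_add_distrib]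

variable {b : n → H} {c : Matrix n n H}

lemma IsComatrix.map_eq (hc : IsComatrix k b c) {T : End k H} (hT : T ∈ actAlgebra k H)
    {M : Matrix n n k} (hM : ∀ j, T (b j) = ∑ i, M i j • b i) : c.map T = c * scalarMat H M := by
  ext i j
  rw [mul_scalarMat_apply, Matrix.map_apply, hc.apply_eq T M hT hM]

variable [DecidableEq n]

/-- The matrix of antipodes of `c`. -/
noncomputable def IsComatrix.inv (_ : IsComatrix k b c) : Matrix n n H :=
  c.map (HopfAlgebra.antipode k)

lemma IsComatrix.map_inv_aut (hc : IsComatrix k b c) (hσ : IsAut σ) {M : Matrix n n k}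
    (hM : ∀ j, σ (b j) = ∑ i, M i j • b i) : scalarMat H M * hc.inv.map σ = hc.inv := by
  have h := hσ.map_mul c hc.inv
  rw [IsComatrix.inv, hc.mul_antipode, Matrix.map_one σ (map_zero σ) hσ.one,
    hc.map_eq hσ.mem hM] at h
  have h2 := congrArg (hc.inv * ·) h
  simp only [IsComatrix.inv] at h2 ⊢
  rw [mul_one, mul_assoc, ← mul_assoc _ c, hc.antipode_mul, one_mul] at h2
  exact h2.symm

lemma IsComatrix.map_inv_skewDer (hc : IsComatrix k b c) (hσ : IsAut σ) (hD : IsSkewDer σ D)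
    {M Y : Matrix n n k} (hM : ∀ j, σ (b j) = ∑ i, M i j • b i)
    (hY : ∀ j, D (b j) = ∑ i, Y i j • b i) :
    scalarMat H M * hc.inv.map D = -(scalarMat H Y * hc.inv) := by
  have h := hD.map_mul c hc.inv
  have h1 : (1 : Matrix n n H).map D = 0 := by
    ext i j
    rw [Matrix.map_apply, Matrix.one_apply]
    split_ifs
    · exact hD.apply_one hσ.one
    · exact map_zero D
  rw [IsComatrix.inv, hc.mul_antipode, h1, hc.map_eq hσ.mem hM, hc.map_eq hD.mem hY] at h
  have h2 := congrArg (hc.inv * ·) h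
  simp only [IsComatrix.inv] at h2 ⊢
  rw [mul_zero, mul_add, mul_assoc, ← mul_assoc _ c, hc.antipode_mul, one_mul, mul_assoc c,
    ← mul_assoc _ c, hc.antipode_mul, one_mul] at h2
  exact eq_neg_of_add_eq_zero_left h2.symm

end Comatrix

section Projection

variable {k H : Type*} [Field k] [Ring H] [HopfAlgebra k H] [FiniteDimensional k H]
  {σ D : End k H}

/-- Maschke-type averaging: if `1` is not in the image of `D`, then right coideals have
`D`-equivariant projections. -/
lemma IsRC.exists_commuting_projection (hσ : IsAut σ) (hD : IsSkewDer σ D) {u : Dual k H}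
    (hu : ∀ x, u (D x) = 0) (hu1 : u 1 = 1) {X : Submodule k H} (hX : IsRC X) :
    ∃ P : End k H, (∀ x, P x ∈ X) ∧ (∀ x ∈ X, P x = x) ∧ ∀ x, P (D x) = D (P x) := by
  classical
  set b := finBasis k H
  obtain ⟨c, hc⟩ := exists_comatrix b.linearIndependent
    (by rw [b.span_eq]; exact fun _ _ _ => trivial)
  obtain ⟨Q, hQ⟩ := Submodule.exists_isCompl X
  set F₀ : End k H := X.projection Q hQ with hF₀
  have hF1 : ∀ x, F₀ x ∈ X := Submodule.projection_apply_mem hQ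
  have hF2 : ∀ x ∈ X, F₀ x = x := fun x hx => Submodule.projection_apply_left hQ ⟨x, hx⟩
  have hmat : ∀ (T : End k H) j, T (b j) = ∑ i, LinearMap.toMatrix b b T i j • b i :=
    fun T j => by simp only [LinearMap.toMatrix_apply]; exact (b.sum_repr _).symm
  set F := LinearMap.toMatrix b b F₀ with hF
  set Y := LinearMap.toMatrix b b D with hYdef
  set M := LinearMap.toMatrix b b σ
  have hact : ∀ f : Dual k H, c.map f = LinearMap.toMatrix b b (act f) := by
    intro f
    ext i j
    rw [Matrix.map_apply, LinearMap.toMatrix_apply, hc.act_eq]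
    simp [Finsupp.single_apply]
  have hFcF : scalarMat H F * c * scalarMat H F = c * scalarMat H F := by
    ext i j
    refine eq_of_dual fun f : Dual k H => ?_
    have : (scalarMat H F * c * scalarMat H F).map f = (c * scalarMat H F).map f := by
      rw [map_mul_scalarMat, map_mul_scalarMat, map_scalarMat_mul, scalarMat_self, hact, hF,
        ← LinearMap.toMatrix_mul, ← LinearMap.toMatrix_mul, ← LinearMap.toMatrix_mul]
      congr 1
      ext x
      exact hF2 _ (hX f _ (hF1 x))
    exact congrFun (congrFun this i) j
  have hFsF : scalarMat H F * hc.inv * scalarMat H F = hc.inv * scalarMat H F := by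
    have := congrArg (fun X : Matrix _ _ H => X.map (HopfAlgebra.antipode k)) hFcF
    simp only [map_mul_scalarMat, map_scalarMat_mul] at this
    exact this
  have hsc : hc.inv * c = 1 := hc.antipode_mul
  set Z := hc.inv * scalarMat H F * c with hZ
  set R : Matrix _ _ k := Z.map u with hR
  have hFR : F * R = R := by
    have : scalarMat H F * Z = Z := by
      rw [hZ, ← mul_assoc, ← mul_assoc, hFsF]
    have h2 := congrArg (fun X : Matrix _ _ H => X.map u) this
    simpa only [map_scalarMat_mul, scalarMat_self] using h2
  have hRF : R * F = F := by
    have : Z * scalarMat H F = scalarMat H F := by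
      rw [hZ, mul_assoc, mul_assoc, ← mul_assoc _ c, hFcF, ← mul_assoc, hsc, one_mul]
    have h2 := congrArg (fun X : Matrix _ _ H => X.map u) this
    simp only [map_mul_scalarMat, scalarMat_self] at h2
    rw [hR, h2]
    ext i j
    change u (algebraMap k H (F i j)) = F i j
    rw [Algebra.algebraMap_eq_smul_one, map_smul, hu1,
      smul_eq_mul, mul_one]
  have hRY : R * Y = Y * R := by
    have h1 : scalarMat H M * Z.map D = Z * scalarMat H Y - scalarMat H Y * Z := by
      rw [hZ, hD.map_mul, map_mul_scalarMat, map_mul_scalarMat, hc.map_eq hD.mem (hmat D),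
        mul_add, ← mul_assoc, ← mul_assoc, ← mul_assoc, ← mul_assoc, ← mul_assoc,
        hc.map_inv_aut hσ (hmat σ), hc.map_inv_skewDer hσ hD (hmat σ) (hmat D), neg_mul, neg_mul,
        ← sub_eq_add_neg]
      simp only [mul_assoc]
      rfl
    have h2 := congrArg (fun X : Matrix _ _ H => X.map u) h1
    have h3 : (Z.map D).map u = 0 := by
      ext i j
      exact hu _
    simp only [map_scalarMat_mul, h3, mul_zero] at h2
    rw [Matrix.map_sub u (map_sub u), map_scalarMat_mul, map_mul_scalarMat, scalarMat_self] at h2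
    exact sub_eq_zero.1 h2.symm
  have hto : ∀ A B : Matrix (Fin (finrank k H)) (Fin (finrank k H)) k, ∀ x,
      Matrix.toLin b b (A * B) x = Matrix.toLin b b A (Matrix.toLin b b B x) := fun A B x => by
    rw [Matrix.toLin_mul b b b, LinearMap.comp_apply]
  have hFto : Matrix.toLin b b F = F₀ := Matrix.toLin_toMatrix _ _ _
  have hYto : Matrix.toLin b b Y = D := Matrix.toLin_toMatrix _ _ _
  refine ⟨Matrix.toLin b b R, fun x => ?_, fun x hx => ?_, fun x => ?_⟩
  · rw [← hFR, hto, hFto]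
    exact hF1 _
  · conv_lhs => rw [← hF2 x hx, ← hFto, ← hto, hRF, hFto, hF2 x hx]
  · rw [← hYto, ← hto, hRY, hto]

end Projection

section Minimal

variable {k H : Type*} [Field k] [Ring H] [HopfAlgebra k H] [FiniteDimensional k H]
  {σ D : End k H} {κ : k}

/-- If `1` is not in the image of `D`, then nonvanishing of a power of `D` is detected on simple
right coideals. -/
lemma exists_isSimpleRC_pow_ne_zero (hσ : IsAut σ) (hD : IsSkewDer σ D)
    (h1 : ∀ z, D z ≠ 1) {n : ℕ} (hn : D ^ n ≠ 0) :
    ∃ M : Submodule k H, IsSimpleRC M ∧ ∃ m ∈ M, (D ^ n) m ≠ 0 := by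
  obtain ⟨u, hu0, hu⟩ : ∃ u : Dual k H, u 1 = 1 ∧ ∀ x, u (D x) = 0 := by
    obtain ⟨u, hu, hle⟩ := Submodule.exists_le_ker_of_notMem (K := k) (p := LinearMap.range D)
      (v := (1 : H))
      (by rintro ⟨z, hz⟩; exact h1 z hz)
    refine ⟨(u 1)⁻¹ • u, ?_, fun x => ?_⟩
    · rw [LinearMap.smul_apply, smul_eq_mul, inv_mul_cancel₀ hu]
    · rw [LinearMap.smul_apply, LinearMap.mem_ker.1 (hle ⟨x, rfl⟩), smul_zero]
  have hE : D ^ n ∈ actAlgebra k H := pow_mem hD.mem n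
  obtain ⟨M, ⟨hM, m, hmM, hm⟩, hmin⟩ := WellFounded.has_min
    (InvImage.wf (fun M : Submodule k H => finrank k M) wellFounded_lt)
    {M | IsRC M ∧ ∃ m ∈ M, (D ^ n) m ≠ 0} (by
      by_contra hcon
      refine hn (LinearMap.ext fun x => ?_)
      by_contra hx
      exact hcon ⟨⊤, fun _ _ _ => trivial, x, trivial, hx⟩)
  have hsmall : ∀ Y : Submodule k H, IsRC Y → finrank k Y < finrank k M →
      ∀ y ∈ Y, (D ^ n) y = 0 := fun Y hY hlt y hy => by
    by_contra hcon
    exact hmin Y ⟨hY, y, hy, hcon⟩ hlt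
  refine ⟨M, ⟨hM, ?_, fun Y hYM hY hY0 => ?_⟩, m, hmM, hm⟩
  · rintro rfl
    rw [(Submodule.mem_bot k).1 hmM, map_zero] at hm
    exact hm rfl
  by_contra hne
  have hEY : (D ^ n) m ∈ Y := by
    by_contra hcon
    obtain ⟨φ, hφ, hle⟩ := Submodule.exists_le_ker_of_notMem hcon
    have hrank := finrank_map_add_finrank_inf_ker M (coact φ)
    have hpos : 0 < finrank k (M ⊓ LinearMap.ker (coact φ) : Submodule k H) := by
      refine (Submodule.one_le_finrank_iff.2 hY0).trans (Submodule.finrank_mono ?_)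
      exact le_inf hYM fun y hy => coact_eq_zero_of_le_ker hY hle hy
    have h2 := hsmall _ (hM.map_coact φ) (by omega) _ (Submodule.mem_map_of_mem hmM)
    rw [mem_actAlgebra.1 hE] at h2
    apply hφ
    rw [← counit_coact, h2, map_zero]
  obtain ⟨P, hP1, hP2, hPD⟩ := hY.exists_commuting_projection hσ hD hu hu0
  have hPE : ∀ j x, P ((D ^ j) x) = (D ^ j) (P x) := by
    intro j
    induction j with
    | zero => simp
    | succ j ih => intro x; rw [pow_succ', End.mul_apply, hPD, ih, ← End.mul_apply]
  apply hm
  rw [← hP2 _ hEY, hPE]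
  exact hsmall Y hY (Submodule.finrank_lt_finrank_of_lt (lt_of_le_of_ne hYM hne)) _ (hP1 m)

end Minimal

section Explicit

variable {k H : Type*} [Field k] [Ring H] [HopfAlgebra k H] {σ D : End k H} {κ : k}

lemma pow_apply_of_skew_comm (hκ : ∀ x, D (σ x) = κ • σ (D x)) (s : ℕ) (x : H) :
    (D ^ s) (σ x) = κ ^ s • σ ((D ^ s) x) := by
  induction s with
  | zero => simp
  | succ s ih =>
    rw [pow_succ', End.mul_apply, ih, map_smul, hκ, smul_smul, pow_succ κ, End.mul_apply]

lemma IsComatrix.exists_apply_eq_one {n : Type*} [Fintype n] [DecidableEq n] [Nonempty n]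
    {b : n → H} {c : Matrix n n H} (hc : IsComatrix k b c) (hσ : IsAut σ) (hD : IsSkewDer σ D)
    {M Y F F' : Matrix n n k} (hM : ∀ j, σ (b j) = ∑ i, M i j • b i)
    (hY : ∀ j, D (b j) = ∑ i, Y i j • b i) (hMF : M * F = F' * M)
    (hYF : ∀ i j, (Y * F) i j = (F' * Y) i j + if i = j then 1 else 0) : ∃ z, D z = 1 := by
  have hYF' : Y * F = F' * Y + 1 := by
    ext i j
    rw [hYF, Matrix.add_apply, Matrix.one_apply]
  have hcs : c * hc.inv = 1 := hc.mul_antipode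
  have h : (c * scalarMat H F * hc.inv).map D = 1 := by
    have h1 : c * scalarMat H M * scalarMat H F * hc.inv.map D =
        -(c * scalarMat H (F' * Y) * hc.inv) := by
      rw [mul_assoc c, ← scalarMat_mul, hMF, scalarMat_mul, ← mul_assoc,
        mul_assoc _ _ (hc.inv.map D),
        hc.map_inv_skewDer hσ hD hM hY, mul_neg, ← mul_assoc, mul_assoc c, ← scalarMat_mul]
    have h2 : c * scalarMat H Y * scalarMat H F * hc.inv =
        c * scalarMat H (F' * Y) * hc.inv + 1 := by
      rw [mul_assoc c, ← scalarMat_mul, hYF', scalarMat, Matrix.map_add _ (map_add _),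
        Matrix.map_one _ (map_zero _) (map_one _), mul_add, mul_one, add_mul, hcs]
    rw [hD.map_mul, map_mul_scalarMat, map_mul_scalarMat, hc.map_eq hσ.mem hM,
      hc.map_eq hD.mem hY, h1, h2, neg_add_cancel_left]
  let i := Classical.arbitrary n
  refine ⟨(c * scalarMat H F * hc.inv) i i, ?_⟩
  have := congrFun (congrFun h i) i
  rwa [Matrix.map_apply, Matrix.one_apply_eq] at this

variable [FiniteDimensional k H] [IsAlgClosed k] [CharZero k]

lemma exists_apply_eq_one_of_isRC (hσ : IsAut σ) (hD : IsSkewDer σ D)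
    (hκ : ∀ x, D (σ x) = κ • σ (D x)) {n : ℕ} (hn : 0 < n) (hprim : IsPrimitiveRoot κ (n + 1))
    (hnil : D ^ (n + 1) = 0) {M : Submodule k H} (hM : IsRC M) (hfin : finrank k M = n + 1)
    (hne : ∃ m ∈ M, (D ^ n) m ≠ 0) : ∃ z, D z = 1 := by
  obtain ⟨μ, v, hvM, hv, hσv⟩ := exists_eigenvector_notMem hσ.fin.orderOf_pos
    (pow_orderOf_eq_one σ) (W := M) (N := LinearMap.ker (D ^ n))
    (fun x hx => hM.apply_mem hσ.mem hx) (fun h => by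
      obtain ⟨m, hm, hm0⟩ := hne
      exact hm0 (h hm))
  have hv0 : v ≠ 0 := by rintro rfl; exact hv (Submodule.zero_mem _)
  have hμ : μ ≠ 0 := by
    rintro rfl
    have := pow_eq_one_of_eigenvector (pow_orderOf_eq_one σ) hσv hv0
    rw [zero_pow hσ.fin.orderOf_pos.ne'] at this
    exact zero_ne_one this
  set b : Fin (n + 1) → H := fun j => (D ^ (n - j)) v with hb
  set m : Fin (n + 1) → k := fun j => μ * κ ^ (j + 1 : ℕ) with hm
  have hσb : ∀ j, σ (b j) = m j • b j := by
    intro j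
    have h := pow_apply_of_skew_comm hκ (n - j) v
    rw [hσv, map_smul] at h
    have hj : (j + 1 : ℕ) + (n - j) = n + 1 := by omega
    simp only [hm, hb]
    rw [mul_comm, mul_smul]
    rw [h, smul_smul, ← pow_add, hj, hprim.pow_eq_one, one_smul]
  have hb0 : ∀ j, b j ≠ 0 := by
    intro j h
    apply hv
    have hj : n = j + (n - j) := by omega
    rw [LinearMap.mem_ker, hj, pow_add, End.mul_apply]
    exact (congrArg (D ^ (j : ℕ)) h).trans (map_zero _)
  have hli : LinearIndependent k b := by
    refine End.eigenvectors_linearIndependent' σ m (fun i j hij => ?_) b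
      fun j => ⟨End.mem_eigenspace_iff.2 (hσb j), hb0 j⟩
    have h1 := mul_left_cancel₀ hμ hij
    rw [pow_succ, pow_succ] at h1
    exact Fin.ext (hprim.pow_inj i.2 j.2
      (mul_right_cancel₀ (hprim.ne_zero (Nat.succ_ne_zero n)) h1))
  have hspan : Submodule.span k (Set.range b) = M := by
    refine Submodule.eq_of_le_of_finrank_eq (Submodule.span_le.2 ?_) ?_
    · rintro _ ⟨j, rfl⟩
      exact hM.apply_mem (pow_mem hD.mem _) hvM
    · rw [finrank_span_eq_card hli, Fintype.card_fin, hfin]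
  obtain ⟨c, hc⟩ := exists_comatrix hli (by rw [hspan]; exact hM)
  let q : ℕ → k := fun i => ∑ l ∈ Finset.range i, κ ^ l
  have hq : ∀ i, q (i + 1) = κ * q i + 1 := fun i => geom_sum_succ
  have hqn : q (n + 1) = 0 := hprim.geom_sum_eq_zero (by omega)
  refine hc.exists_apply_eq_one hσ hD (M := Matrix.diagonal m)
    (Y := Matrix.of fun i j => if (i : ℕ) + 1 = j then 1 else 0)
    (F := Matrix.of fun i j => if (i : ℕ) = j + 1 then q i else 0)
    (F' := Matrix.of fun i j => if (i : ℕ) = j + 1 then κ * q i else 0) (fun j => ?_)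
    (fun j => ?_) ?_ ?_
  · rw [hσb, Finset.sum_eq_single j]
    · rw [Matrix.diagonal_apply_eq]
    · intro i _ hi
      rw [Matrix.diagonal_apply_ne _ hi, zero_smul]
    · exact fun h => absurd (Finset.mem_univ _) h
  · refine Fin.cases ?_ (fun j => ?_) j
    · rw [Finset.sum_eq_zero fun i _ => by simp]
      have : D (b 0) = (D ^ (n + 1)) v := by rw [pow_succ', End.mul_apply]; simp [hb]
      rw [this, hnil, LinearMap.zero_apply]
    · rw [Finset.sum_eq_single j.castSucc]
      · have hj : n - j = n - (j + 1) + 1 := by omega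
        simp [hb, hj, pow_succ']
      · intro i _ hi
        rw [Matrix.of_apply, if_neg, zero_smul]
        intro h
        apply hi
        ext
        simpa using h
      · exact fun h => absurd (Finset.mem_univ _) h
  · ext i j
    rw [Matrix.diagonal_mul, Matrix.mul_diagonal, Matrix.of_apply, Matrix.of_apply]
    split_ifs with h
    · rw [hm]
      dsimp only
      rw [h, pow_succ κ (j + 1 : ℕ)]
      ring
    · simp
  · intro i j
    have h1 : ((Matrix.of fun i j => if (i : ℕ) + 1 = j then 1 else 0 :
        Matrix (Fin (n + 1)) (Fin (n + 1)) k) *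
        Matrix.of fun i j : Fin (n + 1) => if (i : ℕ) = j + 1 then q i else 0) i j =
          if i = j then q (i + 1) else 0 := by
      rw [Matrix.mul_apply]
      refine Fin.lastCases ?_ (fun i => ?_) i
      · rw [Finset.sum_eq_zero fun l _ => by
          rw [Matrix.of_apply, if_neg, zero_mul]
          simp only [Fin.val_last]
          omega]
        simp [hqn]
      · rw [Finset.sum_eq_single i.succ]
        · simp [Fin.ext_iff]
        · intro l _ hl
          rw [Matrix.of_apply, if_neg, zero_mul]
          intro h
          apply hl
          ext
          simpa using h.symm
        · exact fun h => absurd (Finset.mem_univ _) h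
    have h2 : ((Matrix.of fun i j => if (i : ℕ) = j + 1 then κ * q i else 0 :
        Matrix (Fin (n + 1)) (Fin (n + 1)) k) *
        Matrix.of fun i j : Fin (n + 1) => if (i : ℕ) + 1 = j then (1 : k) else 0) i j =
        if i = j then κ * q i else 0 := by
      rw [Matrix.mul_apply]
      refine Fin.cases ?_ (fun i => ?_) i
      · rw [Finset.sum_eq_zero fun l _ => by
          rw [Matrix.of_apply, if_neg, zero_mul]
          simp]
        simp [q]
      · rw [Finset.sum_eq_single i.castSucc]
        · simp [Fin.ext_iff]
        · intro l _ hl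
          rw [Matrix.of_apply, if_neg, zero_mul]
          intro h
          apply hl
          ext
          simpa using h.symm
        · exact fun h => absurd (Finset.mem_univ _) h
    rw [h1, h2]
    split_ifs
    · rw [hq]
    · rw [add_zero]

variable {p t : ℕ} {C : Fin t → Submodule k H}

lemma exists_apply_eq_one (hp : p.Prime) (hC : ∀ i, IsMatrixSubcoalg k H p (C i))
    (hsup : coradical k H = Submodule.span k (grouplikes k H) ⊔ ⨆ i, C i)
    (hσ : IsAut σ) (hD : IsSkewDer σ D) (hne : ∀ c : k, D ≠ c • (σ - 1))
    (hκ : ∀ x, D (σ x) = κ • σ (D x)) (hprim : IsPrimitiveRoot κ p) (hnil : D ^ p = 0) :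
    ∃ z, D z = 1 ∧ σ z = κ • z := by
  have hz : ∃ z, D z = 1 := by
    by_contra! hcon
    have hE : D ^ (p - 1) ≠ 0 := by
      intro h
      have h1 := (linearIndependent_ev hσ hD hne hκ p fun m h0 hm =>
        geom_sum_ne_zero_of_lt h0 (hprim.eq_orderOf ▸ hm)).ne_zero
          (⟨0, hσ.fin.orderOf_pos⟩, ⟨p - 1, Nat.sub_one_lt hp.ne_zero⟩)
      apply h1
      simp [ev, h]
    obtain ⟨M, hM, m, hm, hm0⟩ := exists_isSimpleRC_pow_ne_zero hσ hD hcon hE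
    rcases hM.eq_line_or hC hsup with ⟨g, hg, rfl⟩ | ⟨-, hfin⟩
    · obtain ⟨a, rfl⟩ := Submodule.mem_span_singleton.1 hm
      apply hm0
      have hp1 : p - 1 = (p - 2) + 1 := by have := hp.two_le; omega
      rw [hp1, pow_succ, End.mul_apply, map_smul,
        skewDer_grouplike hσ hD (hprim.ne_one hp.one_lt) hκ hg, smul_zero, map_zero]
    · obtain ⟨n, rfl⟩ := Nat.exists_eq_succ_of_ne_zero hp.ne_zero
      obtain ⟨z, hz⟩ := exists_apply_eq_one_of_isRC hσ hD hκ (by have := hp.two_le; omega)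
        hprim hnil hM.1 hfin ⟨m, hm, hm0⟩
      exact hcon z hz
  obtain ⟨z, hz⟩ := hz
  have h1 : (1 : H) ≠ 0 := fun h => by
    have h2 := Bialgebra.counit_one (R := k) (A := H)
    rw [h, map_zero] at h2
    exact zero_ne_one h2
  obtain ⟨μ, x, hxW, hxN, hσx⟩ := exists_eigenvector_notMem hσ.fin.orderOf_pos
    (pow_orderOf_eq_one σ) (W := (Submodule.span k {(1 : H)}).comap D) (N := LinearMap.ker D)
    (fun x hx => by
      obtain ⟨a, ha⟩ := Submodule.mem_span_singleton.1 hx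
      refine Submodule.mem_span_singleton.2 ⟨κ * a, ?_⟩
      rw [hκ, ← ha, map_smul, hσ.one, smul_smul])
    (fun h => by
      have h2 : z ∈ LinearMap.ker D := h (Submodule.mem_span_singleton.2 ⟨1, by rw [hz, one_smul]⟩)
      exact h1 (hz.symm.trans h2))
  obtain ⟨a, ha⟩ := Submodule.mem_span_singleton.1 hxW
  have ha0 : a ≠ 0 := by
    rintro rfl
    rw [zero_smul] at ha
    exact hxN ha.symm
  have hDz : D (a⁻¹ • x) = 1 := by rw [map_smul, ← ha, smul_smul, inv_mul_cancel₀ ha0, one_smul]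
  have hσz : σ (a⁻¹ • x) = μ • a⁻¹ • x := by rw [map_smul, hσx, smul_comm]
  refine ⟨a⁻¹ • x, hDz, ?_⟩
  have h3 := hκ (a⁻¹ • x)
  rw [hσz, map_smul, hDz, hσ.one] at h3
  rw [hσz, smul_left_injective k h1 h3]

end Explicit

section Cyclic

variable {k H : Type*} [Field k] [AddCommGroup H] [Module k H] [Coalgebra k H]

variable (k) in
/-- The map `f ↦ act f x`. -/
noncomputable def actHom (x : H) : Dual k H →ₗ[k] H where
  toFun f := act f x
  map_add' f g := eq_of_dual (k := k) fun h => by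
    simp only [map_add, apply_act, LinearMap.add_apply]
  map_smul' c f := eq_of_dual (k := k) fun h => by
    simp only [map_smul, apply_act, LinearMap.smul_apply, RingHom.id_apply]

variable (k) in
/-- The right coideal generated by an element. -/
noncomputable def cyc (x : H) : Submodule k H := LinearMap.range (actHom k x)

lemma act_mem_cyc (f : Dual k H) (x : H) : act f x ∈ cyc k x := ⟨f, rfl⟩

lemma mem_cyc (x : H) : x ∈ cyc k x := by
  have := act_mem_cyc (k := k) Coalgebra.counit x
  rwa [act_counit] at this

lemma isRC_cyc (x : H) : IsRC (cyc k x) := by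
  rintro f _ ⟨g, rfl⟩
  change act f (act g x) ∈ _
  rw [← End.mul_apply, eq_act (mem_actAlgebra.1 (mul_mem (act_mem f) (act_mem g)))]
  exact act_mem_cyc _ x

lemma IsRC.cyc_le {X : Submodule k H} (hX : IsRC X) {x : H} (hx : x ∈ X) : cyc k x ≤ X := by
  rintro _ ⟨f, rfl⟩
  exact hX f x hx

variable [FiniteDimensional k H]

lemma finrank_cyc_le {x : H} {R : Submodule k H} (hR : ∀ f : Dual k H, coact f x ∈ R) :
    finrank k (cyc k x) ≤ finrank k R := by
  have h1 := Subspace.finrank_add_finrank_dualAnnihilator_eq R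
  have h2 := (actHom k x).finrank_range_add_finrank_ker
  rw [Subspace.dual_finrank_eq] at h2
  have h3 : R.dualAnnihilator ≤ LinearMap.ker (actHom k x) := by
    intro f hf
    refine eq_of_dual (k := k) fun g : Dual k H => ?_
    change g (act f x) = g 0
    rw [apply_act, map_zero]
    exact (Submodule.mem_dualAnnihilator f).1 hf _ (hR g)
  have h4 := Submodule.finrank_mono h3
  rw [cyc]
  omega

end Cyclic

section Bound

variable {k H : Type*} [Field k] [Ring H] [HopfAlgebra k H] {σ D : End k H} {κ : k} {z : H}

lemma IsAut.map_pow (hσ : IsAut σ) (x : H) (j : ℕ) : σ (x ^ j) = σ x ^ j := by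
  induction j with
  | zero => rw [pow_zero, pow_zero, hσ.one]
  | succ j ih => rw [pow_succ, hσ.mul, ih, pow_succ]

lemma IsSkewDer.apply_pow_mul (hD : IsSkewDer σ D) (hz : D z = 1)
    (hσz : σ z = κ • z) (j : ℕ) {r : H} (hr : D r = 0) :
    D (z ^ (j + 1) * r) = (∑ i ∈ Finset.range (j + 1), κ ^ i) • (z ^ j * r) := by
  induction j with
  | zero => simp [hD.leibniz, hr, hz]
  | succ j ih =>
    rw [pow_succ' z (j + 1), mul_assoc, hD.leibniz, ih, hz, hσz, one_mul, smul_mul_smul_comm,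
      ← mul_assoc, ← pow_succ', geom_sum_succ (n := j + 1), add_smul, one_smul]

variable [FiniteDimensional k H] {p : ℕ}

lemma mul_finrank_ker_le (hD : IsSkewDer σ D) (hz : D z = 1) (hσz : σ z = κ • z)
    (hprim : IsPrimitiveRoot κ p) : p * finrank k (LinearMap.ker D) ≤ finrank k H := by
  have key : ∀ N ≤ p, ∀ r : ℕ → H, (∀ j, D (r j) = 0) →
      ∑ j ∈ Finset.range N, z ^ j * r j = 0 → ∀ j < N, r j = 0 := by
    intro N
    induction N with
    | zero => intro _ r _ _ j hj; exact absurd hj (Nat.not_lt_zero j)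
    | succ N ih =>
      intro hN r hr hsum j hj
      rw [Finset.sum_range_succ'] at hsum
      have h1 : ∀ j < N, r (j + 1) = 0 := by
        intro j hj
        have h2 := ih (by omega)
          (fun j => (∑ i ∈ Finset.range (j + 1), κ ^ i) • r (j + 1))
          (fun j => by rw [map_smul, hr, smul_zero]) (by
            have h3 := congrArg D hsum
            rw [map_add, map_sum, map_zero, pow_zero, one_mul, hr, add_zero] at h3
            rw [← h3]
            refine Finset.sum_congr rfl fun j _ => ?_
            rw [hD.apply_pow_mul hz hσz j (hr _), mul_smul_comm]) j hj
        exact (smul_eq_zero.1 h2).resolve_left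
          (geom_sum_ne_zero_of_lt (Nat.succ_pos j) (by rw [← hprim.eq_orderOf]; omega))
      rcases j with _ | j
      · rw [Finset.sum_eq_zero fun j hj => by rw [h1 j (Finset.mem_range.1 hj), mul_zero]] at hsum
        simpa using hsum
      · exact h1 j (by omega)
  let Φ : (Fin p → LinearMap.ker D) →ₗ[k] H :=
    ∑ j : Fin p, LinearMap.mulLeft k (z ^ (j : ℕ)) ∘ₗ (LinearMap.ker D).subtype ∘ₗ
      LinearMap.proj j
  have hΦ : Function.Injective Φ := by
    rw [injective_iff_map_eq_zero]
    intro r hr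
    let s : ℕ → H := fun j => if h : j < p then r ⟨j, h⟩ else 0
    have h1 := key p le_rfl s (fun j => by
      by_cases h : j < p
      · simp only [s, h, dif_pos]
        exact (r ⟨j, h⟩).2
      · simp [s, h]) (by
      rw [← hr, Finset.sum_range]
      simp [Φ, s])
    ext j
    have h2 := h1 j j.2
    simpa [s] using h2
  have h := LinearMap.finrank_le_finrank_of_injective hΦ
  rwa [finrank_pi_fintype, Finset.sum_const, Finset.card_univ, Fintype.card_fin,
    smul_eq_mul] at h

lemma finrank_eker_le [IsAlgClosed k] [CharZero k] (hp : p.Prime) (hdim : finrank k H = p ^ 3)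
    (hσ : IsAut σ) (hD : IsSkewDer σ D) (hκ : ∀ x, D (σ x) = κ • σ (D x)) (hz : D z = 1)
    (hσz : σ z = κ • z) (hprim : IsPrimitiveRoot κ p) (hord : orderOf σ = p) (hnil : D ^ p = 0)
    {ν : k} (hν : ν ≠ 0) : finrank k (eker σ D ν) ≤ p := by
  have h1 := mul_finrank_ker_le hD hz hσz hprim
  have h2 := hD.orderOf_mul_finrank_eker_le hσ hκ ⟨p, hnil⟩ hν
  rw [hord] at h2
  rw [hdim] at h1
  have h3 : p ^ 2 * finrank k (eker σ D ν) ≤ p ^ 2 * p :=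
    calc p ^ 2 * finrank k (eker σ D ν) = p * (p * finrank k (eker σ D ν)) := by ring
      _ ≤ p * finrank k (LinearMap.ker D) := Nat.mul_le_mul_left _ h2
      _ ≤ p ^ 2 * p := by rw [← pow_succ]; exact h1
  exact Nat.le_of_mul_le_mul_left h3 (pow_pos hp.pos 2)

end Bound

section Grouplike

variable {k H : Type*} [Field k] [Ring H] [HopfAlgebra k H] {σ D : End k H} {κ : k}

lemma pow_mem_grouplikes {g : H} (hg : g ∈ grouplikes k H) (n : ℕ) : g ^ n ∈ grouplikes k H := by
  constructor
  · intro h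
    have h1 := Bialgebra.counit_pow (R := k) g n
    rw [counit_grouplike hg, one_pow, h, map_zero] at h1
    exact zero_ne_one h1
  · have h1 := Bialgebra.comul_pow (R := k) g n
    rw [show CoalgebraStruct.comul (R := k) g = g ⊗ₜ[k] g from hg.2,
      Algebra.TensorProduct.tmul_pow] at h1
    exact h1

lemma one_mem_grouplikes : (1 : H) ∈ grouplikes k H := by
  constructor
  · intro h
    have h1 := Bialgebra.counit_one (R := k) (A := H)
    rw [h, map_zero] at h1
    exact zero_ne_one h1
  · exact Bialgebra.comul_one (R := k) (A := H)

lemma coact_mem_eker (hσ : IsAut σ) (hD : IsSkewDer σ D) {x : H} {ν : k} (hx : x ∈ eker σ D ν)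
    (f : Dual k H) : coact f x ∈ eker σ D ν := by
  obtain ⟨h1, h2⟩ := mem_eker.1 hx
  refine mem_eker.2 ⟨?_, ?_⟩
  · rw [mem_actAlgebra.1 hD.mem, h1, map_zero]
  · rw [mem_actAlgebra.1 hσ.mem, h2, map_smul]

variable [FiniteDimensional k H] {n : ℕ} {C : Submodule k H} {e : Fin n → Fin n → H}

lemma le_finrank_eker_inf (he : IsMultMatrix k H n C e) (hσ : IsAut σ) (hD : IsSkewDer σ D)
    {i : Fin n} {v : H} (hv : v ∈ row (k := k) e i) (hv0 : v ≠ 0) {c : k} (hvc : v ∈ eker σ D c) :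
    n ≤ finrank k (C ⊓ eker σ D c : Submodule k H) := by
  obtain ⟨a, ha⟩ := (Submodule.mem_span_range_iff_exists_fun k).1 hv
  obtain ⟨j₀, hj₀⟩ : ∃ j, a j ≠ 0 := by
    by_contra! h
    apply hv0
    rw [← ha]
    exact Finset.sum_eq_zero fun j _ => by rw [h, zero_smul]
  have hw : ∀ l, ∑ j, a j • e l j ∈ C ⊓ eker σ D c := by
    intro l
    refine ⟨?_, ?_⟩
    · rw [he.2.1]
      exact sum_mem fun j _ => Submodule.smul_mem _ _ (Submodule.subset_span ⟨(l, j), rfl⟩)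
    · obtain ⟨f, hf⟩ := exists_dual_multMatrix he i l
      have h1 := coact_mem_eker hσ hD hvc f
      rw [← ha, map_sum] at h1
      rw [SetLike.mem_coe]
      refine (Finset.sum_congr rfl fun j _ => ?_ : _ = ∑ j, a j • e l j) ▸ h1
      rw [map_smul, coact_multMatrix he, Finset.sum_eq_single l, hf]
      · simp
      · intro m _ hm
        rw [hf, if_neg (fun h => hm h.2), zero_smul]
      · exact fun h => absurd (Finset.mem_univ _) h
  have hli : LinearIndependent k fun l => (⟨_, hw l⟩ : (C ⊓ eker σ D c : Submodule k H)) := by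
    refine Fintype.linearIndependent_iff.2 fun b hb l => ?_
    have h1 := congrArg Subtype.val hb
    simp only [AddSubmonoidClass.coe_finsetSum, Submodule.coe_smul, ZeroMemClass.coe_zero] at h1
    have h2 := Fintype.linearIndependent_iff.1 he.1 (fun q => b q.1 * a q.2) (by
      rw [Fintype.sum_prod_type, ← h1]
      refine Finset.sum_congr rfl fun l _ => ?_
      rw [Finset.smul_sum]
      exact Finset.sum_congr rfl fun j _ => mul_smul _ _ _) (l, j₀)
    exact (mul_eq_zero.1 h2).resolve_right hj₀
  have := hli.fintype_card_le_finrank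
  rwa [Fintype.card_fin] at this

variable [IsAlgClosed k] [CharZero k]

/-- If the kernels `eker σ D ν` are small, then `σ` fixes all grouplikes. -/
lemma apply_grouplike_eq_self (hp : n.Prime) (he : IsMultMatrix k H n C e)
    (hdisj : Disjoint (Submodule.span k (grouplikes k H)) C)
    (hσ : IsAut σ) (hD : IsSkewDer σ D) (hκ : ∀ x, D (σ x) = κ • σ (D x))
    (hprim : IsPrimitiveRoot κ n) (hord : orderOf σ = n) (hnil : D ^ n = 0)
    (hle : ∀ ν : k, ν ≠ 0 → finrank k (eker σ D ν) ≤ n) {g : H} (hg : g ∈ grouplikes k H) :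
    σ g = g := by
  obtain ⟨ω, hω⟩ := exists_apply_grouplike hσ.mem hg
  have hσn : σ ^ n = 1 := hord ▸ pow_orderOf_eq_one σ
  have hωn := pow_eq_one_of_eigenvector hσn hω hg.1
  by_cases hω1 : ω = 1
  · rw [hω, hω1, one_smul]
  exfalso
  have : Fact n.Prime := ⟨hp⟩
  have hωprim : IsPrimitiveRoot ω n := by
    have h := IsPrimitiveRoot.orderOf ω
    rwa [orderOf_eq_prime hωn hω1] at h
  set i : Fin n := ⟨0, hp.pos⟩
  have hS := isSimpleRC_row he i
  obtain ⟨x, hxS, hx0, hDx⟩ := exists_ker_of_isNilpotent ⟨n, hnil⟩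
    (fun x hx => hS.1.apply_mem hD.mem hx) hS.2.1
  obtain ⟨c, v, ⟨hvS, hDv⟩, hv0, hσv⟩ := exists_eigenvector_notMem hp.pos hσn
    (W := row (k := k) e i ⊓ LinearMap.ker D) (N := ⊥)
    (fun y hy => ⟨hS.1.apply_mem hσ.mem hy.1, by
      have hy2 : D y = 0 := hy.2
      rw [SetLike.mem_coe, LinearMap.mem_ker, hκ, hy2, map_zero, smul_zero]⟩)
    (fun h => hx0 ((Submodule.mem_bot k).1 (h ⟨hxS, hDx⟩)))
  have hv0' : v ≠ 0 := fun h => hv0 ((Submodule.mem_bot k).2 h)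
  have hcn := pow_eq_one_of_eigenvector hσn hσv hv0'
  have hc0 : c ≠ 0 := by
    rintro rfl
    rw [zero_pow hp.ne_zero] at hcn
    exact zero_ne_one hcn
  have : NeZero n := ⟨hp.ne_zero⟩
  obtain ⟨s, -, hs⟩ := hωprim.eq_pow_of_pow_eq_one hcn
  have hgs := pow_mem_grouplikes hg s
  have hge : g ^ s ∈ eker σ D c := by
    refine mem_eker.2 ⟨skewDer_grouplike hσ hD (hprim.ne_one hp.one_lt) hκ hgs, ?_⟩
    rw [hσ.map_pow, hω, smul_pow, hs]
  have h1 := le_finrank_eker_inf he hσ hD hvS hv0' (mem_eker.2 ⟨hDv, hσv⟩)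
  have h2 : (C ⊓ eker σ D c : Submodule k H) < eker σ D c := by
    refine lt_of_le_of_ne inf_le_right fun h => hgs.1 ?_
    rw [← h] at hge
    exact Submodule.disjoint_def.1 hdisj _ (Submodule.subset_span hgs) hge.1
  have h3 := Submodule.finrank_lt_finrank_of_lt h2
  have h4 := hle c hc0
  omega

end Grouplike

section Cyclic

lemma finrank_inf_ker_pow_le {k V : Type*} [Field k] [AddCommGroup V] [Module k V]
    [FiniteDimensional k V] {T : End k V} {M : Submodule k V} (hM : ∀ x ∈ M, T x ∈ M) (n : ℕ) :
    finrank k (M ⊓ LinearMap.ker (T ^ n) : Submodule k V) ≤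
      n * finrank k (M ⊓ LinearMap.ker T : Submodule k V) := by
  induction n with
  | zero => simp [End.one_eq_id, LinearMap.ker_id]
  | succ n ih =>
    have h := finrank_map_add_finrank_inf_ker (M ⊓ LinearMap.ker (T ^ (n + 1))) T
    have h1 : (M ⊓ LinearMap.ker (T ^ (n + 1))).map T ≤ M ⊓ LinearMap.ker (T ^ n) := by
      rintro _ ⟨x, ⟨hx, hxT⟩, rfl⟩
      refine ⟨hM x hx, ?_⟩
      have h2 : (T ^ (n + 1)) x = 0 := hxT
      rwa [pow_succ, End.mul_apply] at h2
    have h2 := Submodule.finrank_mono h1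
    have h3 : finrank k (M ⊓ LinearMap.ker (T ^ (n + 1)) ⊓ LinearMap.ker T : Submodule k V) ≤
        finrank k (M ⊓ LinearMap.ker T : Submodule k V) :=
      Submodule.finrank_mono (inf_le_inf_right _ inf_le_left)
    rw [Nat.add_one_mul]
    omega

variable {k H : Type*} [Field k] [Ring H] [HopfAlgebra k H]
  {σ D : End k H} {κ : k} {p t : ℕ} {C : Fin t → Submodule k H} {z : H}

lemma notMem_coradical (hC : ∀ i, IsMatrixSubcoalg k H p (C i))
    (hdisj : Disjoint (Submodule.span k (grouplikes k H)) (⨆ i, C i))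
    (hsup : coradical k H = Submodule.span k (grouplikes k H) ⊔ ⨆ i, C i)
    (hD : IsSkewDer σ D) (hDg : ∀ g ∈ grouplikes k H, D g = 0) (hz : D z = 1) :
    z ∉ coradical k H := by
  intro h
  rw [hsup] at h
  obtain ⟨a, ha, c, hc, rfl⟩ := Submodule.mem_sup.1 h
  have hDa : D a = 0 := (Submodule.span_le.2 fun g hg => hDg g hg :
    Submodule.span k (grouplikes k H) ≤ LinearMap.ker D) ha
  have hDC : (⨆ i, C i) ≤ (⨆ i, C i).comap D := iSup_le fun i x hx => by
    obtain ⟨e, he⟩ := hC i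
    have hCi : IsRC (C i) := by
      intro f y hy
      have hle : C i ≤ (C i).comap (act f) := by
        conv_lhs => rw [he.2.1]
        rw [Submodule.span_le]
        rintro _ ⟨⟨a, b⟩, rfl⟩
        change act f (e a b) ∈ C i
        rw [act_multMatrix he, he.2.1]
        exact sum_mem fun l _ => Submodule.smul_mem _ _ (Submodule.subset_span ⟨(a, l), rfl⟩)
      exact hle hy
    exact Submodule.mem_iSup_of_mem i (hCi.apply_mem hD.mem hx)
  rw [map_add, hDa, zero_add] at hz
  have h1 : (1 : H) ∈ ⨆ i, C i := hz ▸ hDC hc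
  exact (one_mem_grouplikes (k := k)).1
    (Submodule.disjoint_def.1 hdisj 1 (Submodule.subset_span one_mem_grouplikes) h1)

variable [FiniteDimensional k H]

lemma finrank_cyc_le_succ (hσ : IsAut σ) (hD : IsSkewDer σ D) (hz : D z = 1)
    (hσz : σ z = κ • z) : finrank k (cyc k z) ≤ finrank k (eker σ D κ) + 1 := by
  have h1 : ∀ f : Dual k H, coact f z ∈ eker σ D κ ⊔ Submodule.span k {z} := by
    intro f
    have h2 : coact f z = (coact f z - f 1 • z) + f 1 • z := (sub_add_cancel _ _).symm
    rw [h2]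
    refine Submodule.add_mem_sup (mem_eker.2 ⟨?_, ?_⟩)
      (Submodule.smul_mem _ _ (Submodule.mem_span_singleton_self z))
    · rw [map_sub, mem_actAlgebra.1 hD.mem, map_smul, hz, coact_grouplike one_mem_grouplikes,
        sub_self]
    · rw [map_sub, mem_actAlgebra.1 hσ.mem, map_smul, hσz, map_smul, smul_sub, smul_comm κ]
  calc finrank k (cyc k z) ≤ finrank k (eker σ D κ ⊔ Submodule.span k {z} : Submodule k H) :=
        finrank_cyc_le h1
    _ ≤ finrank k (eker σ D κ) + finrank k (Submodule.span k {z}) :=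
        Submodule.finrank_add_le_finrank_add_finrank _ _
    _ ≤ finrank k (eker σ D κ) + 1 := by
        have := finrank_span_le_card (R := k) ({z} : Set H)
        simp only [Set.toFinset_singleton, Finset.card_singleton] at this
        omega

/-- Proper right coideals containing `1` of the right coideal generated by `z` are trivial. -/
lemma eq_span_one_of_lt_cyc (hC : ∀ i, IsMatrixSubcoalg k H p (C i))
    (hsup : coradical k H = Submodule.span k (grouplikes k H) ⊔ ⨆ i, C i)
    (hσ : IsAut σ) (hσg : ∀ g ∈ grouplikes k H, σ g = g) (hσz : σ z = κ • z) (hκ1 : κ ≠ 1)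
    (hle : finrank k (cyc k z) ≤ p + 1) {X : Submodule k H} (hX : IsRC X) (h1 : (1 : H) ∈ X)
    (hlt : X < cyc k z) : X = Submodule.span k {(1 : H)} ∧ finrank k (cyc k z) = p + 1 := by
  obtain ⟨X', ⟨hX', hXX', hlt'⟩, hmax⟩ := WellFounded.has_min
    (wellFounded_gt (α := Submodule k H)) {Y | IsRC Y ∧ X ≤ Y ∧ Y < cyc k z} ⟨X, hX, le_rfl, hlt⟩
  have hcov : ∀ Y, IsRC Y → X' ≤ Y → Y ≤ cyc k z → Y = X' ∨ Y = cyc k z := by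
    intro Y hY hle' hYU
    by_contra! hcon
    exact hmax Y ⟨hY, hXX'.trans hle', lt_of_le_of_ne hYU hcon.2⟩
      (lt_of_le_of_ne hle' hcon.1.symm)
  have hspan : Submodule.span k {(1 : H)} ≤ X := by simpa using h1
  have hf1 : finrank k (Submodule.span k {(1 : H)}) = 1 :=
    finrank_span_singleton (one_mem_grouplikes (k := k)).1
  have hm1 := Submodule.finrank_mono hspan
  have hm2 := Submodule.finrank_mono hXX'
  rcases finrank_of_covering hC hsup hX' (isRC_cyc z) hlt' hcov with h | ⟨g, hg, h⟩
  · refine ⟨(Submodule.eq_of_le_of_finrank_le hspan (by omega)).symm, by omega⟩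
  · exfalso
    have h2 := h (Coalgebra.counit ∘ₗ σ) z (mem_cyc z)
    rw [← eq_act (mem_actAlgebra.1 hσ.mem), LinearMap.comp_apply, hσg g hg, counit_grouplike hg,
      hσz, ← sub_smul] at h2
    have h3 := (Submodule.smul_mem_iff _ (sub_ne_zero.2 hκ1)).1 h2
    exact hlt'.not_ge (hX'.cyc_le h3)

lemma cyc_le_coradical [IsAlgClosed k] [CharZero k]
    (hC : ∀ i, IsMatrixSubcoalg k H p (C i))
    (hsup : coradical k H = Submodule.span k (grouplikes k H) ⊔ ⨆ i, C i)
    (hσ : IsAut σ) (hD : IsSkewDer σ D) (hκ : ∀ x, D (σ x) = κ • σ (D x)) (hz : D z = 1)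
    (hσz : σ z = κ • z) (hκ0 : κ ≠ 0) (hκ1 : κ ≠ 1) (hnil : D ^ p = 0)
    (hle : ∀ ν : k, ν ≠ 0 → finrank k (eker σ D ν) ≤ p)
    (hσg : ∀ g ∈ grouplikes k H, σ g = g) : cyc k z ≤ coradical k H := by
  have hU := isRC_cyc (k := k) z
  have h1U : (1 : H) ∈ cyc k z := hz ▸ hU.apply_mem hD.mem (mem_cyc z)
  have hUle : finrank k (cyc k z) ≤ p + 1 :=
    (finrank_cyc_le_succ hσ hD hz hσz).trans (Nat.add_le_add_right (hle κ hκ0) 1)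
  set L : Submodule k H := Submodule.span k {(1 : H)} with hLdef
  have hL : IsSimpleRC L := isSimpleRC_line one_mem_grouplikes
  have h1L : (1 : H) ∈ L := Submodule.mem_span_singleton_self 1
  have hLU : L ≤ cyc k z := by simpa [hLdef] using h1U
  have hfL : finrank k L = 1 := finrank_span_singleton (one_mem_grouplikes (k := k)).1
  have hD1 : D 1 = 0 := hD.apply_one hσ.one
  have hLD : L ≤ LinearMap.ker D := by simpa [hLdef] using hD1
  have key : ∀ X : Submodule k H, IsRC X → (1 : H) ∈ X → X < cyc k z →
      X = L ∧ finrank k (cyc k z) = p + 1 := fun X hX h1 hlt =>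
    eq_span_one_of_lt_cyc hC hsup hσ hσg hσz hκ1 hUle hX h1 hlt
  have hUdim : finrank k (cyc k z) = p + 1 := by
    refine (key L hL.1 h1L (lt_of_le_of_ne hLU fun h => ?_)).2
    have h2 : D z = 0 := hLD (h ▸ mem_cyc z)
    exact (one_mem_grouplikes (k := k)).1 (hz.symm.trans h2)
  have hker : ¬ cyc k z ⊓ LinearMap.ker D ≤ L := by
    intro h
    have h2 := finrank_inf_ker_pow_le (fun x hx => hU.apply_mem hD.mem hx) p (M := cyc k z) (T := D)
    rw [hnil, LinearMap.ker_zero, inf_top_eq, hUdim] at h2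
    have h3 := Submodule.finrank_mono h
    have h4 := Nat.mul_le_mul_left p (h3.trans_eq hfL)
    omega
  obtain ⟨μ, v, ⟨hvU, hDv⟩, hvL, hσv⟩ := exists_eigenvector_notMem hσ.fin.orderOf_pos
    (pow_orderOf_eq_one σ) (W := cyc k z ⊓ LinearMap.ker D)
    (fun x hx => ⟨hU.apply_mem hσ.mem hx.1, by
      have hx2 : D x = 0 := hx.2
      rw [SetLike.mem_coe, LinearMap.mem_ker, hκ, hx2, map_zero, smul_zero]⟩) hker
  have hv0 : v ≠ 0 := by rintro rfl; exact hvL (Submodule.zero_mem _)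
  have hμ : μ ≠ 0 := ne_zero_of_hasEigenvalue hσ
    (End.hasEigenvalue_of_hasEigenvector ⟨End.mem_eigenspace_iff.2 hσv, hv0⟩)
  have hV : finrank k (cyc k v) ≤ p :=
    (finrank_cyc_le fun f => coact_mem_eker hσ hD (mem_eker.2 ⟨hDv, hσv⟩) f).trans (hle μ hμ)
  have hVU : cyc k v ≤ cyc k z := hU.cyc_le hvU
  have hsupL : ∀ Y ≤ cyc k v, IsRC Y → ¬ Y ≤ L → Y ⊔ L = cyc k z := by
    intro Y hYV hY hYL
    by_contra hne
    have h2 := (key (Y ⊔ L) (hY.sup hL.1) (Submodule.mem_sup_right h1L)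
      (lt_of_le_of_ne (sup_le (hYV.trans hVU) hLU) hne)).1
    exact hYL (h2 ▸ le_sup_left)
  have hdimY : ∀ Y ≤ cyc k v, IsRC Y → ¬ Y ≤ L → p ≤ finrank k Y := by
    intro Y hYV hY hYL
    have h2 := Submodule.finrank_add_le_finrank_add_finrank Y L
    rw [hsupL Y hYV hY hYL, hUdim, hfL] at h2
    omega
  have hVL : ¬ cyc k v ≤ L := fun h => hvL (h (mem_cyc v))
  have h1V : (1 : H) ∉ cyc k v := by
    intro h
    have h2 : L ≤ cyc k v := by simpa [hLdef] using h
    have h3 := hsupL _ le_rfl (isRC_cyc v) hVL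
    rw [sup_eq_left.2 h2] at h3
    rw [h3] at hV
    omega
  have hsimple : IsSimpleRC (cyc k v) := by
    refine ⟨isRC_cyc v, fun h => hv0 ?_, fun Y hYV hY hY0 => ?_⟩
    · exact (Submodule.mem_bot k).1 (h ▸ mem_cyc v)
    · refine Submodule.eq_of_le_of_finrank_le hYV (hV.trans (hdimY Y hYV hY fun hYL => h1V ?_))
      exact hYV (hL.2.2 Y hYL hY hY0 ▸ h1L)
  rw [← hsupL _ le_rfl (isRC_cyc v) hVL]
  exact sup_le hsimple.le_coradical hL.le_coradical

end Cyclic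

end HopfDual

open HopfClass in
/-- Let `p` be an odd prime and `H` a nonsemisimple, nonpointed, non-copointed Hopf algebra of
dimension `p³` whose grouplikes have order `p` and whose coradical is isomorphic as a
coalgebra to `kG(H) ⊕ M*(p,k)^t` with `t ≥ p − 3`. Then the dual Hopf algebra `H*` has no
nontrivial skew-primitive elements. -/
theorem dual_has_no_nontrivial_skewPrimitives
    (k : Type*) [Field k] [IsAlgClosed k] [CharZero k]
    (H : Type*) [Ring H] [HopfAlgebra k H] [FiniteDimensional k H]
    (p : ℕ) (hp : p.Prime) (hodd : Odd p)
    (hdim : Module.finrank k H = p ^ 3)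
    (hnss : ¬ IsSemisimpleRing H) (hnp : ¬ IsPointed k H) (hncop : ¬ IsCopointed k H)
    (hG : (grouplikes k H).ncard = p)
    (t : ℕ) (ht : p - 3 ≤ t)
    (C : Fin t → Submodule k H)
    (hC : ∀ i, IsMatrixSubcoalg k H p (C i))
    (hindep : iSupIndep (fun i : Option (Fin t) =>
      i.elim (Submodule.span k (grouplikes k H)) C))
    (hsup : coradical k H = Submodule.span k (grouplikes k H) ⊔ ⨆ i, C i) :
    HasNoNontrivialSkewPrimitivesWrt k (dualComul k H) := by
  by_contra hH
  obtain ⟨σ, D, κ, hσ, hD, hne, hκ, hprim, hord, hnil⟩ :=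
    HopfDual.exists_nilpotent_skewDer hp hdim hncop hH
  obtain ⟨z, hz, hσz⟩ := HopfDual.exists_apply_eq_one hp hC hsup hσ hD hne hκ hprim hnil
  have hle : ∀ ν : k, ν ≠ 0 → Module.finrank k (HopfDual.eker σ D ν) ≤ p := fun ν hν =>
    HopfDual.finrank_eker_le hp hdim hσ hD hκ hz hσz hprim hord hnil hν
  have hκ1 := hprim.ne_one hp.one_lt
  have hdisj : Disjoint (Submodule.span k (grouplikes k H)) (⨆ i, C i) :=
    (hindep none).mono_right (iSup_le fun i =>
      le_iSup₂_of_le (some i) (Option.some_ne_none i) le_rfl)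
  let i₀ : Fin t := ⟨0, HopfDual.pos_of_not_isPointed hC hsup hnp⟩
  obtain ⟨e, he⟩ := hC i₀
  have hσg : ∀ g ∈ grouplikes k H, σ g = g := fun g hg =>
    HopfDual.apply_grouplike_eq_self hp he (hdisj.mono_right (le_iSup C i₀)) hσ hD hκ hprim hord
      hnil hle hg
  exact HopfDual.notMem_coradical hC hdisj hsup hD
    (fun g hg => HopfDual.skewDer_grouplike hσ hD hκ1 hκ hg) hz
    (HopfDual.cyc_le_coradical hC hsup hσ hD hκ hz hσz (hprim.ne_zero hp.ne_zero) hκ1 hnil hle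
      hσg (HopfDual.mem_cyc z))
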